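/- Lower bound for approximation by logarithmic-derivative families (second order): let W = {Re z > 0}, N ≥ 2, M ≥ 0, and fix l = m + α with m ≥ 1 integer and 0 < α ≤ 1 (so l > 1). Let ψ(x,ζ,w) be defined on [0,1] × ℂ^N × W^M, of class C² in x, such that ψ, ∂ψ/∂x and ∂²ψ/∂x² are each continuous in x, entire in ζ, holomorphic in w, and satisfy the exponential growth bound sup_x |·| ≤ A·e^{u(N+M)^v}·e^{b(N+M)^t(‖ζ‖₁^d+‖w‖₁^d)} with A,u,v,b,t,d ∈ [1,∞). Let k(x,ζ,w) be continuous in x and entire of exponential type in (ζ,w), whose restriction to ℝ^N × (ℝ₊)^M is bounded polynomially in N+M on Ω_{N,M}. Assume furthermore that for all (ζ,w) ∈ Ω_{N,M}: |1/ψ(0,ζ,w)| ≤ C₀ e^{α₀(M+N)^{β₀}} and (∂ψ/∂x)(0,ζ,w) = 0. Let b_{M,N} > 0 be such that b_{M,N} and 1/b_{M,N} are bounded polynomially in M+N. Then there exists a constant C̃ > 0 (depending only on l and all the above growth constants) and a function h ∈ Λ_l([0,1]) ∩ C^m([0,1]) vanishing identically on [0,1/20], such that for all (ζ,w) ∈ Ω_{N,M}: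 sup_{x ∈ [0,1]} | h(x) − (1/b_{M,N})·( k(x,ζ,w) + ∂/∂x( (∂ψ/∂x)/ψ )(x,ζ,w) ) | ≥ C̃ / ( (N+M)^l (ln(N+M))^l ). -/

import Mathlib

open Set

noncomputable section

/-- The interval `I = [0,1]`. -/
def I01 : Set ℝ := Icc 0 1

/-- The one-dimensional Hölder class `Λ_l([0,1])`, `l = m + α`, `0 < α ≤ 1`. -/
def HolderClass1 (m : ℕ) (α : ℝ) (f : ℝ → ℝ) : Prop :=
  ContDiffOn ℝ m f I01 ∧
  (∀ j ≤ m, ∀ x ∈ I01, |iteratedDerivWithin j f I01 x| ≤ 1) ∧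
  ∀ x ∈ I01, ∀ y ∈ I01,
    |iteratedDerivWithin m f I01 x - iteratedDerivWithin m f I01 y| ≤ |x - y| ^ α

/-- The product `W^M` of half-planes `W = {Re z > 0}`. -/
def Wset (M : ℕ) : Set (Fin M → ℂ) := {w | ∀ i, 0 < (w i).re}

/-- A function `g(x,ζ,w)` on `[0,1] × ℂ^N × W^M` which is continuous in `x`, entire in `ζ`,
holomorphic in `w`, with the exponential growth bound
`‖g‖ ≤ A e^{u(N+M)^v} e^{b(N+M)^t(‖ζ‖₁^d + ‖w‖₁^d)}`. -/
def GoodFamily (N M : ℕ) (A u v b t d : ℝ)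
    (g : ℝ → (Fin N → ℂ) → (Fin M → ℂ) → ℂ) : Prop :=
  (∀ ζ : Fin N → ℂ, ∀ w ∈ Wset M, ContinuousOn (fun x => g x ζ w) I01) ∧
  (∀ x ∈ I01, ∀ w ∈ Wset M, AnalyticOnNhd ℂ (fun ζ => g x ζ w) univ) ∧
  (∀ x ∈ I01, ∀ ζ : Fin N → ℂ, AnalyticOnNhd ℂ (fun w => g x ζ w) (Wset M)) ∧
  ∀ ζ : Fin N → ℂ, ∀ w ∈ Wset M, ∀ x ∈ I01,
    ‖g x ζ w‖ ≤ A * Real.exp (u * ((N:ℝ) + M) ^ v) *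
      Real.exp (b * ((N:ℝ) + M) ^ t * ((∑ j, ‖ζ j‖) ^ d + (∑ i, ‖w i‖) ^ d))

/-- Membership in `Ω_{N,M}` (real parameters). -/
def InOmega (N M : ℕ) (B₁ r₁ ε : ℝ) (a : Fin M → ℝ)
    (ζ : Fin N → ℝ) (w : Fin M → ℝ) : Prop :=
  (∀ j, |ζ j| ≤ B₁ * ((M:ℝ) + N) ^ r₁) ∧
  ∀ i, 0 < w i ∧ |w i - a i| ≤ (1 - ε) * a i

lemma aux_kernel (q : ℝ) (hq0 : 0 ≤ q) (hq1 : q < 1) (K : ℕ) (hK : 0 < K) :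
    ∃ (nd : Fin K → ℂ) (L : Fin K → ℂ → ℂ), (∀ k, ‖nd k‖ = 1) ∧
      (∀ z, ‖z‖ ≤ q → ∑ k, ‖L k z‖ ≤ 1 / (1 - q)) ∧
      ∀ j < K, ∀ z, ∑ k, L k z * nd k ^ j = z ^ j := by
  have hprim := Complex.isPrimitiveRoot_exp K hK.ne'
  set ω := Complex.exp (2 * Real.pi * Complex.I / K) with hω
  have hω0 : ω ≠ 0 := Complex.exp_ne_zero _
  have hωK : ω ^ K = 1 := hprim.pow_eq_one
  have hnω : ‖ω‖ = 1 := Complex.norm_eq_one_of_pow_eq_one hωK hK.ne'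
  have hKc : (K : ℂ) ≠ 0 := by exact_mod_cast hK.ne'
  have hKr : (0 : ℝ) < K := by exact_mod_cast hK
  refine ⟨fun k => ω ^ (k : ℕ),
    fun k z => (K : ℂ)⁻¹ * ∑ l ∈ Finset.range K, z ^ l * ((ω ^ (k : ℕ))⁻¹) ^ l, ?_, ?_, ?_⟩
  · intro k; simp [hnω]
  · intro z hz
    have h1 : ∀ k : Fin K, ‖(K : ℂ)⁻¹ * ∑ l ∈ Finset.range K, z ^ l * ((ω ^ (k : ℕ))⁻¹) ^ l‖
        ≤ (K : ℝ)⁻¹ * (1 / (1 - q)) := by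
      intro k
      rw [norm_mul, norm_inv, Complex.norm_natCast]
      gcongr
      calc ‖∑ l ∈ Finset.range K, z ^ l * ((ω ^ (k : ℕ))⁻¹) ^ l‖
          ≤ ∑ l ∈ Finset.range K, ‖z ^ l * ((ω ^ (k : ℕ))⁻¹) ^ l‖ := norm_sum_le _ _
        _ ≤ ∑ l ∈ Finset.range K, q ^ l := by
            apply Finset.sum_le_sum; intro l _
            simp only [norm_mul, norm_pow, norm_inv, hnω, one_pow, inv_one, mul_one]
            gcongr
        _ ≤ 1 / (1 - q) := by
            rw [one_div, ← tsum_geometric_of_lt_one hq0 hq1]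
            exact (summable_geometric_of_lt_one hq0 hq1).sum_le_tsum _ (fun i _ => by positivity)
    calc _ ≤ ∑ k : Fin K, (K : ℝ)⁻¹ * (1 / (1 - q)) := Finset.sum_le_sum (fun k _ => h1 k)
      _ = 1 / (1 - q) := by
        rw [Finset.sum_const, Finset.card_univ, Fintype.card_fin, nsmul_eq_mul]
        field_simp
  · intro j hj z
    have h2 : ∀ k : Fin K, (K : ℂ)⁻¹ * (∑ l ∈ Finset.range K, z ^ l * ((ω ^ (k : ℕ))⁻¹) ^ l) * (ω ^ (k : ℕ)) ^ j
        = ∑ l ∈ Finset.range K, (K : ℂ)⁻¹ * z ^ l * (ω ^ j * (ω ^ l)⁻¹) ^ (k : ℕ) := by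
      intro k
      rw [Finset.mul_sum, Finset.sum_mul]
      apply Finset.sum_congr rfl
      intro l _
      rw [mul_pow, inv_pow, inv_pow, ← pow_mul, ← pow_mul, ← pow_mul, ← pow_mul, mul_comm j, mul_comm l]
      ring
    simp_rw [h2]
    rw [Finset.sum_comm]
    rw [Finset.sum_eq_single_of_mem j (Finset.mem_range.2 hj)]
    · rw [mul_inv_cancel₀ (pow_ne_zero _ hω0)]
      simp [hKc]
    · intro l hl hlj
      rw [← Finset.mul_sum]
      have hl' := Finset.mem_range.1 hl
      set x := ω ^ j * (ω ^ l)⁻¹ with hx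
      have hx1 : x ≠ 1 := by
        intro h
        apply hlj
        have : ω ^ j = ω ^ l := by
          rw [hx] at h
          field_simp at h
          exact h
        exact (hprim.pow_inj hj hl' this).symm
      have hxK : x ^ K = 1 := by
        rw [hx, mul_pow, inv_pow, ← pow_mul, ← pow_mul, mul_comm j, mul_comm l, pow_mul, pow_mul, hωK]
        simp
      have h3 : ∑ k : Fin K, x ^ (k : ℕ) = 0 := by
        rw [Fin.sum_univ_eq_sum_range (fun k => x ^ k)]
        have := geom_sum_mul x K
        rw [hxK, sub_self] at this
        exact (mul_eq_zero.1 this).resolve_right (sub_ne_zero.2 hx1)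
      rw [h3, mul_zero]

lemma aux_oneD (q : ℝ) (hq0 : 0 < q) (hq1 : q < 1) (K : ℕ)
    (nd : Fin K → ℂ) (L : Fin K → ℂ → ℂ) (hnd : ∀ k, ‖nd k‖ = 1)
    (hL : ∀ z, ‖z‖ ≤ q → ∑ k, ‖L k z‖ ≤ 1 / (1 - q))
    (hex : ∀ j < K, ∀ z, ∑ k, L k z * nd k ^ j = z ^ j)
    (f : ℂ → ℂ) (E : ℝ) (hf : DifferentiableOn ℂ f (Metric.closedBall 0 (1 / q)))
    (hE : ∀ z, ‖z‖ ≤ 1 / q → ‖f z‖ ≤ E) (z : ℂ) (hz : ‖z‖ ≤ q) :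
    ‖f z - ∑ k, L k z * f (nd k)‖ ≤ (1 + 1 / (1 - q)) * E * q ^ K * (1 / (1 - q)) := by
  have hE0 : 0 ≤ E := le_trans (norm_nonneg _) (hE 0 (by simp; positivity))
  have hρ : 1 < 1 / q := by rw [lt_div_iff₀ hq0]; linarith
  have hfb : DifferentiableOn ℂ f (Metric.ball 0 (1 / q)) := hf.mono Metric.ball_subset_closedBall
  set c : ℕ → ℂ := fun j => ((j.factorial : ℂ))⁻¹ * iteratedDeriv j f 0 with hc
  have hsum : ∀ s : ℂ, ‖s‖ < 1 / q → HasSum (fun j => c j * s ^ j) (f s) := by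
    intro s hs
    have := Complex.hasSum_taylorSeries_on_ball hfb (z := s) (by simpa using hs)
    have heq : (fun j => c j * s ^ j) = fun n => ((n.factorial : ℂ))⁻¹ • (s - 0) ^ n • iteratedDeriv n f 0 := by
      funext j
      simp only [hc, smul_eq_mul, sub_zero]; ring
    rw [heq]; exact this
  have hcb : ∀ j, ‖c j‖ ≤ E * q ^ j := by
    intro j
    have := Complex.norm_iteratedDeriv_le_of_forall_mem_sphere_norm_le (f := f) (c := 0) (R := 1 / q) (C := E) j
      (by positivity) (hf.diffContOnCl_ball le_rfl) (fun z hz => hE z (by simpa using (mem_sphere_iff_norm.1 hz).le))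
    have hfac : (0 : ℝ) < j.factorial := by exact_mod_cast j.factorial_pos
    rw [hc, norm_mul, norm_inv, Complex.norm_natCast, inv_mul_le_iff₀ hfac]
    refine this.trans (le_of_eq ?_)
    rw [div_pow, one_pow]; field_simp
  have hdiff : HasSum (fun j => c j * (z ^ j - ∑ k, L k z * nd k ^ j)) (f z - ∑ k, L k z * f (nd k)) := by
    have h1 := hsum z (by linarith)
    have h2 : HasSum (fun j => ∑ k, L k z * (c j * nd k ^ j)) (∑ k, L k z * f (nd k)) := by
      apply hasSum_sum
      intro k _
      exact (hsum (nd k) (by rw [hnd]; exact hρ)).mul_left _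
    have heq : (fun j => c j * (z ^ j - ∑ k, L k z * nd k ^ j)) =
        fun j => c j * z ^ j - ∑ k, L k z * (c j * nd k ^ j) := by
      funext j
      rw [mul_sub, Finset.mul_sum]
      congr 1
      apply Finset.sum_congr rfl; intros; ring
    rw [heq]; exact h1.sub h2
  have hshift := (hasSum_nat_add_iff (f := fun j => c j * (z ^ j - ∑ k, L k z * nd k ^ j)) K
    (g := f z - ∑ k, L k z * f (nd k))).2 (by
      have h0 : ∑ i ∈ Finset.range K, c i * (z ^ i - ∑ k, L k z * nd k ^ i) = 0 := by
        apply Finset.sum_eq_zero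
        intro i hi
        rw [hex i (Finset.mem_range.1 hi)]; simp
      rw [h0, add_zero]
      exact hdiff)
  have hg : HasSum (fun j : ℕ => (1 + 1 / (1 - q)) * E * q ^ K * q ^ j) ((1 + 1 / (1 - q)) * E * q ^ K * (1 / (1 - q))) := by
    rw [one_div]
    exact (hasSum_geometric_of_lt_one hq0.le hq1).mul_left _
  refine hshift.norm_le_of_bounded hg ?_
  intro j
  have hG : ‖z ^ (j + K) - ∑ k, L k z * nd k ^ (j + K)‖ ≤ 1 + 1 / (1 - q) := by
    refine (norm_sub_le _ _).trans (add_le_add ?_ ?_)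
    · rw [norm_pow]; exact pow_le_one₀ (norm_nonneg _) (by linarith)
    · refine (norm_sum_le _ _).trans (le_trans (Finset.sum_le_sum ?_) (hL z hz))
      intro k _
      rw [norm_mul, norm_pow, hnd, one_pow, mul_one]
  rw [norm_mul]
  have hq' : 0 < 1 - q := by linarith
  calc ‖c (j + K)‖ * ‖z ^ (j + K) - ∑ k, L k z * nd k ^ (j + K)‖
      ≤ (E * q ^ (j + K)) * (1 + 1 / (1 - q)) := by gcongr; exact hcb _
    _ = _ := by rw [pow_add]; ring

/-- Separately holomorphic on the polydisc of radius `r`. -/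
def SepHol (r : ℝ) (P : ℕ) (F : (Fin P → ℂ) → ℂ) : Prop :=
  ∀ z : Fin P → ℂ, (∀ i, ‖z i‖ ≤ r) → ∀ i,
    DifferentiableOn ℂ (fun s => F (Function.update z i s)) (Metric.closedBall 0 r)

lemma aux_multiD (q : ℝ) (hq0 : 0 < q) (hq1 : q < 1) (K : ℕ) (hK : 0 < K) (P : ℕ) :
    ∃ (ι : Type) (_ : Fintype ι) (nd : ι → Fin P → ℂ) (L : ι → (Fin P → ℂ) → ℂ),
      Fintype.card ι = K ^ P ∧
      ∀ (F : (Fin P → ℂ) → ℂ) (E : ℝ), SepHol (1 / q) P F →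
        (∀ z, (∀ i, ‖z i‖ ≤ 1 / q) → ‖F z‖ ≤ E) →
        ∀ z, (∀ i, ‖z i‖ ≤ q) →
        ‖F z - ∑ k, F (nd k) * L k z‖ ≤
          P * (1 / (1 - q)) ^ P * ((1 + 1 / (1 - q)) * E * q ^ K * (1 / (1 - q))) := by
  induction P with
  | zero =>
    refine ⟨Unit, inferInstance, fun _ => Fin.elim0, fun _ _ => 1, by simp, ?_⟩
    intro F E _ _ z _
    have : z = Fin.elim0 := Subsingleton.elim _ _
    subst this
    simp
  | succ P ih =>
    obtain ⟨ι, hι, nd', L', hcard, hF'⟩ := ih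
    obtain ⟨nd, L, hnd, hL, hex⟩ := aux_kernel q hq0.le hq1 K hK
    have hρ : 1 < 1 / q := by rw [lt_div_iff₀ hq0]; linarith
    have hq' : 0 < 1 - q := by linarith
    refine ⟨Fin K × ι, inferInstance, fun p => Fin.cons (nd p.1) (nd' p.2),
      fun p z => L p.1 (z 0) * L' p.2 (Fin.tail z), ?_, ?_⟩
    · rw [Fintype.card_prod, hcard, Fintype.card_fin, pow_succ]; ring
    intro F E hF hE z hz
    have hE0 : 0 ≤ E := le_trans (norm_nonneg _) (hE 0 (by intro i; simp; positivity))
    set e := (1 + 1 / (1 - q)) * E * q ^ K * (1 / (1 - q)) with he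
    have he0 : 0 ≤ e := by positivity
    have hztail : ∀ i, ‖Fin.tail z i‖ ≤ q := fun i => hz i.succ
    have hcons : ∀ (s : ℂ) (y : Fin P → ℂ), ‖s‖ ≤ 1 / q → (∀ i, ‖y i‖ ≤ 1 / q) →
        ∀ i, ‖(Fin.cons s y : Fin (P + 1) → ℂ) i‖ ≤ 1 / q := by
      intro s y hs hy i
      refine Fin.cases ?_ ?_ i
      · simpa using hs
      · intro j; simpa using hy j
    have hzt : ∀ i, ‖Fin.tail z i‖ ≤ 1 / q := fun i => (hztail i).trans (by linarith)
    have h1 : ‖F z - ∑ k, L k (z 0) * F (Fin.cons (nd k) (Fin.tail z))‖ ≤ e := by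
      have := aux_oneD q hq0 hq1 K nd L hnd hL hex (fun s => F (Fin.cons s (Fin.tail z))) E ?_ ?_ (z 0) (hz 0)
      · simpa only [Fin.cons_self_tail] using this
      · have := hF z (fun i => (hz i).trans (by linarith)) 0
        have h0 : ∀ s, Function.update z 0 s = Fin.cons s (Fin.tail z) := by
          intro s
          conv_lhs => rw [← Fin.cons_self_tail z]
          rw [Fin.update_cons_zero]
        simpa only [h0] using this
      · intro s hs
        exact hE _ (hcons s _ hs hzt)
    have h2 : ∀ k, ‖F (Fin.cons (nd k) (Fin.tail z)) - ∑ j, F (Fin.cons (nd k) (nd' j)) * L' j (Fin.tail z)‖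
        ≤ P * (1 / (1 - q)) ^ P * e := by
      intro k
      refine hF' (fun y => F (Fin.cons (nd k) y)) E ?_ ?_ _ hztail
      · intro y hy i
        have := hF (Fin.cons (nd k) y) (hcons _ _ (by rw [hnd]; exact hρ.le) hy) i.succ
        simpa only [← Fin.cons_update] using this
      · intro y hy
        exact hE _ (hcons _ _ (by rw [hnd]; exact hρ.le) hy)
    have h3 : ∑ p : Fin K × ι, F (Fin.cons (nd p.1) (nd' p.2)) * (L p.1 (z 0) * L' p.2 (Fin.tail z))
        = ∑ k, L k (z 0) * ∑ j, F (Fin.cons (nd k) (nd' j)) * L' j (Fin.tail z) := by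
      rw [Fintype.sum_prod_type]
      apply Finset.sum_congr rfl; intro k _
      rw [Finset.mul_sum]
      apply Finset.sum_congr rfl; intro j _; ring
    rw [h3]
    have h4 : F z - ∑ k, L k (z 0) * ∑ j, F (Fin.cons (nd k) (nd' j)) * L' j (Fin.tail z)
        = (F z - ∑ k, L k (z 0) * F (Fin.cons (nd k) (Fin.tail z))) +
          ∑ k, L k (z 0) * (F (Fin.cons (nd k) (Fin.tail z)) - ∑ j, F (Fin.cons (nd k) (nd' j)) * L' j (Fin.tail z)) := by
      simp only [mul_sub, Finset.sum_sub_distrib]; ring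
    rw [h4]
    have hG1 : 1 ≤ 1 / (1 - q) := by rw [le_div_iff₀ hq']; linarith
    set G := 1 / (1 - q) with hG
    have hG0 : 0 < G := by positivity
    calc _ ≤ e + ∑ k, ‖L k (z 0)‖ * (P * G ^ P * e) := by
          refine (norm_add_le _ _).trans (add_le_add h1 ?_)
          refine (norm_sum_le _ _).trans (Finset.sum_le_sum ?_)
          intro k _
          rw [norm_mul]
          gcongr
          exact h2 k
      _ ≤ e + G * (P * G ^ P * e) := by
          rw [← Finset.sum_mul]
          gcongr
          exact hL _ (hz 0)
      _ ≤ G ^ (P + 1) * e + G * (P * G ^ P * e) := by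
          gcongr
          exact le_mul_of_one_le_left he0 (one_le_pow₀ hG1)
      _ = _ := by push_cast; ring

lemma aux_rank {S ι : Type} [Fintype S] [Fintype ι] [DecidableEq S] (B : Matrix S ι ℂ) (C : Matrix ι S ℂ)
    (h : ∀ k, ∑ j ∈ Finset.univ.erase k, ‖(B * C) j k‖ < ‖(B * C) k k‖) :
    Fintype.card S ≤ Fintype.card ι := by
  have hdet := det_ne_zero_of_sum_col_lt_diag h
  have hr := Matrix.rank_of_isUnit (B * C) ((Matrix.isUnit_iff_isUnit_det _).2 (isUnit_iff_ne_zero.2 hdet))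
  rw [← hr]
  exact (Matrix.rank_mul_le_left B C).trans (Matrix.rank_le_card_width B)

/-- The sign attached to a Boolean. -/
def sgB (b : Bool) : ℂ := if b then 1 else -1

lemma sgB_sq (b : Bool) : sgB b * sgB b = 1 := by cases b <;> simp [sgB]

lemma sgB_norm (b : Bool) : ‖sgB b‖ = 1 := by cases b <;> simp [sgB]

lemma sgB_ne {b c : Bool} (h : b ≠ c) : sgB b = - sgB c := by
  cases b <;> cases c <;> simp_all [sgB]

lemma aux_core (q : ℝ) (hq0 : 0 < q) (hq1 : q < 1) (K : ℕ) (hK : 0 < K) (P n : ℕ) (hn : 1 ≤ n)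
    (U D : Fin n → (Fin P → ℂ) → ℂ) (hU : ∀ i, SepHol (1 / q) P (U i)) (hD : ∀ i, SepHol (1 / q) P (D i))
    (E1 : ℝ) (hUb : ∀ i z, (∀ j, ‖z j‖ ≤ 1 / q) → ‖U i z‖ ≤ E1)
    (hDb : ∀ i z, (∀ j, ‖z j‖ ≤ 1 / q) → ‖D i z‖ ≤ E1)
    (S : Finset (Fin n → Bool)) (pt : (Fin n → Bool) → Fin P → ℂ)
    (hpt : ∀ σ ∈ S, ∀ j, ‖pt σ j‖ ≤ q) (lam : ℝ) (hlam0 : 0 < lam)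
    (hlam : ∀ σ ∈ S, ∀ i, lam ≤ ‖D i (pt σ)‖)
    (hclose : ∀ σ ∈ S, ∀ i, ‖U i (pt σ) - sgB (σ i) * D i (pt σ)‖ ≤ 1 / 4 * ‖D i (pt σ)‖)
    (hnum : (2 : ℝ) ^ n * (P * (1 / (1 - q)) ^ P * ((1 + 1 / (1 - q)) * ((2 * E1) ^ n) ^ n * q ^ K * (1 / (1 - q))))
      ≤ 1 / 4 * (lam ^ n) ^ n) :
    S.card ≤ K ^ P := by
  classical
  obtain ⟨ι, hι, nd, L, hcard, happ⟩ := aux_multiD q hq0 hq1 K hK P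
  have hE10 : 0 ≤ E1 := le_trans (norm_nonneg _) (hDb ⟨0, hn⟩ 0 (by intro i; simp; positivity))
  have hq' : 0 < 1 - q := by linarith
  set H : (Fin n → Bool) → (Fin P → ℂ) → ℂ := fun τ z => (∏ i, (D i z + sgB (τ i) * U i z)) ^ n with hH
  set η := P * (1 / (1 - q)) ^ P * ((1 + 1 / (1 - q)) * ((2 * E1) ^ n) ^ n * q ^ K * (1 / (1 - q))) with hη
  have hη0 : 0 ≤ η := by positivity
  have hHhol : ∀ τ, SepHol (1 / q) P (H τ) := by
    intro τ z hz j
    have h1 : ∀ i ∈ (Finset.univ : Finset (Fin n)), DifferentiableOn ℂ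
        (fun s => D i (Function.update z j s) + sgB (τ i) * U i (Function.update z j s)) (Metric.closedBall 0 (1 / q)) :=
      fun i _ => (hD i z hz j).add ((hU i z hz j).const_mul _)
    exact (DifferentiableOn.fun_finsetProd h1).pow n
  have hHb : ∀ τ z, (∀ j, ‖z j‖ ≤ 1 / q) → ‖H τ z‖ ≤ ((2 * E1) ^ n) ^ n := by
    intro τ z hz
    rw [hH, norm_pow, norm_prod]
    gcongr
    calc _ ≤ ∏ i : Fin n, (2 * E1) := by
          apply Finset.prod_le_prod (fun i _ => norm_nonneg _)
          intro i _
          refine (norm_add_le _ _).trans ?_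
          rw [norm_mul, sgB_norm]
          linarith [hUb i z hz, hDb i z hz]
      _ = _ := by simp
  have happr : ∀ τ, ∀ σ ∈ S, ‖H τ (pt σ) - ∑ k, H τ (nd k) * L k (pt σ)‖ ≤ η :=
    fun τ σ hσ => happ (H τ) _ (hHhol τ) (hHb τ) (pt σ) (hpt σ hσ)
  have hdiagfac : ∀ σ ∈ S, ∀ i, 7 / 4 * ‖D i (pt σ)‖ ≤ ‖D i (pt σ) + sgB (σ i) * U i (pt σ)‖ := by
    intro σ hσ i
    have h1 : D i (pt σ) + sgB (σ i) * U i (pt σ) =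
        2 * D i (pt σ) + sgB (σ i) * (U i (pt σ) - sgB (σ i) * D i (pt σ)) := by
      rw [mul_sub, ← mul_assoc, sgB_sq]; ring
    have h2 := norm_sub_le_norm_add (2 * D i (pt σ)) (sgB (σ i) * (U i (pt σ) - sgB (σ i) * D i (pt σ)))
    rw [h1]
    rw [norm_mul, norm_mul, sgB_norm] at h2
    have := hclose σ hσ i
    norm_num at h2
    linarith
  have hofffac : ∀ σ ∈ S, ∀ τ : Fin n → Bool, ∀ i, τ i ≠ σ i →
      ‖D i (pt σ) + sgB (τ i) * U i (pt σ)‖ ≤ 1 / 7 * ‖D i (pt σ) + sgB (σ i) * U i (pt σ)‖ := by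
    intro σ hσ τ i hi
    have h1 : D i (pt σ) + sgB (τ i) * U i (pt σ) =
        - sgB (σ i) * (U i (pt σ) - sgB (σ i) * D i (pt σ)) := by
      rw [sgB_ne hi, mul_sub, ← mul_assoc, neg_mul, neg_mul (sgB (σ i)) (sgB (σ i)), sgB_sq]; ring
    have h2 := hclose σ hσ i
    have h3 := hdiagfac σ hσ i
    rw [h1, norm_mul, norm_neg, sgB_norm]
    linarith
  have hoff : ∀ σ ∈ S, ∀ τ : Fin n → Bool, τ ≠ σ → ‖H τ (pt σ)‖ ≤ (1 / 7) ^ n * ‖H σ (pt σ)‖ := by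
    intro σ hσ τ hτ
    obtain ⟨i₀, hi₀⟩ := Function.ne_iff.1 hτ
    rw [hH]
    simp only [norm_pow, norm_prod]
    rw [← mul_pow]
    gcongr
    rw [← Finset.mul_prod_erase _ _ (Finset.mem_univ i₀),
      ← Finset.mul_prod_erase _ (fun i => ‖D i (pt σ) + sgB (σ i) * U i (pt σ)‖) (Finset.mem_univ i₀), ← mul_assoc]
    apply mul_le_mul (hofffac σ hσ τ i₀ hi₀) _ (Finset.prod_nonneg (fun i _ => norm_nonneg _)) (by positivity)
    apply Finset.prod_le_prod (fun i _ => norm_nonneg _)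
    intro i _
    by_cases hi : τ i = σ i
    · rw [hi]
    · refine (hofffac σ hσ τ i hi).trans ?_
      linarith [norm_nonneg (D i (pt σ) + sgB (σ i) * U i (pt σ))]
  have hdiag : ∀ σ ∈ S, (lam ^ n) ^ n ≤ ‖H σ (pt σ)‖ := by
    intro σ hσ
    rw [hH]
    simp only [norm_pow, norm_prod]
    gcongr
    calc lam ^ n = ∏ i : Fin n, lam := by simp
      _ ≤ _ := by
        apply Finset.prod_le_prod (fun i _ => hlam0.le)
        intro i _
        linarith [hdiagfac σ hσ i, hlam σ hσ i]
  rw [← hcard, ← Fintype.card_coe S]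
  refine aux_rank (Matrix.of fun (τ : S) k => H τ.1 (nd k)) (Matrix.of fun k (σ : S) => L k (pt σ.1)) ?_
  intro σ
  simp only [Matrix.mul_apply, Matrix.of_apply]
  have hσ := σ.2
  set X := ‖H σ.1 (pt σ.1)‖ with hX
  have hXl : (lam ^ n) ^ n ≤ X := hdiag σ.1 hσ
  have hX0 : 0 < X := lt_of_lt_of_le (by positivity) hXl
  have hlow : X - η ≤ ‖∑ k, H σ.1 (nd k) * L k (pt σ.1)‖ := by
    have h1 := happr σ.1 σ.1 hσ
    have h2 := norm_sub_norm_le (H σ.1 (pt σ.1)) (∑ k, H σ.1 (nd k) * L k (pt σ.1))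
    linarith
  have hup : ∑ τ ∈ Finset.univ.erase σ, ‖∑ k, H τ.1 (nd k) * L k (pt σ.1)‖ ≤ 2 ^ n * ((1 / 7) ^ n * X + η) := by
    calc _ ≤ ∑ τ ∈ Finset.univ.erase σ, ((1 / 7) ^ n * X + η) := by
          apply Finset.sum_le_sum
          intro τ hτ
          have hne : τ.1 ≠ σ.1 := fun h => (Finset.mem_erase.1 hτ).1 (Subtype.ext h)
          have h1 := happr τ.1 σ.1 hσ
          have h2 := hoff σ.1 hσ τ.1 hne
          have h3 := norm_sub_norm_le (∑ k, H τ.1 (nd k) * L k (pt σ.1)) (H τ.1 (pt σ.1))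
          rw [norm_sub_rev] at h1
          linarith
      _ = ((Finset.univ.erase σ).card : ℝ) * ((1 / 7) ^ n * X + η) := by rw [Finset.sum_const, nsmul_eq_mul]
      _ ≤ _ := by
          gcongr
          have h1 : (Finset.univ.erase σ).card ≤ 2 ^ n := by
            calc (Finset.univ.erase σ).card ≤ Fintype.card S := Finset.card_le_univ _
              _ = S.card := Fintype.card_coe S
              _ ≤ Fintype.card (Fin n → Bool) := Finset.card_le_univ _
              _ = 2 ^ n := by simp
          exact_mod_cast h1
  have h27 : (2 : ℝ) ^ n * ((1 / 7) ^ n * X) ≤ 2 / 7 * X := by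
    rw [← mul_assoc, ← mul_pow]
    gcongr
    have : (2 * (1 / 7) : ℝ) ^ n ≤ (2 * (1 / 7)) ^ 1 := pow_le_pow_of_le_one (by norm_num) (by norm_num) hn
    linarith
  have h1η : η ≤ 2 ^ n * η := le_mul_of_one_le_left hη0 (one_le_pow₀ (by norm_num))
  have : 2 ^ n * ((1 / 7) ^ n * X + η) = 2 ^ n * ((1 / 7) ^ n * X) + 2 ^ n * η := by ring
  linarith

lemma aux_ode_seg (y : ℝ) (hy0 : 0 ≤ y) (hy1 : y ≤ 1) (f fp fpp : ℝ → ℂ)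
    (h1 : ∀ x ∈ Icc 0 y, HasDerivWithinAt f (fp x) (Icc 0 y) x)
    (h2 : ∀ x ∈ Icc 0 y, HasDerivWithinAt fp (fpp x) (Icc 0 y) x) (Lam : ℝ)
    (hg : ∀ x ∈ Icc 0 y, ‖(fpp x * f x - fp x ^ 2) / f x ^ 2‖ ≤ Lam)
    (h0 : ∀ x ∈ Icc 0 y, f x ≠ 0) :
    ‖(f y)⁻¹‖ ≤ ‖(f 0)⁻¹‖ * Real.exp (‖fp 0 / f 0‖ + Lam) := by
  have hLam : 0 ≤ Lam := le_trans (norm_nonneg _) (hg 0 ⟨le_rfl, hy0⟩)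
  have hL : ∀ x ∈ Icc 0 y, HasDerivWithinAt (fun x => fp x / f x) ((fpp x * f x - fp x ^ 2) / f x ^ 2) (Icc 0 y) x := by
    intro x hx
    have := (h2 x hx).fun_div (h1 x hx) (h0 x hx)
    rwa [← sq] at this
  have hLb : ∀ x ∈ Icc 0 y, ‖fp x / f x‖ ≤ ‖fp 0 / f 0‖ + Lam := by
    intro x hx
    have := norm_image_sub_le_of_norm_deriv_le_segment' hL (fun x hx => hg x ⟨hx.1, hx.2.le⟩) x hx
    have h3 := norm_sub_norm_le (fp x / f x) (fp 0 / f 0)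
    have h4 : Lam * (x - 0) ≤ Lam := by
      have : x - 0 ≤ 1 := by linarith [hx.2]
      nlinarith
    linarith
  have hinv : ∀ x ∈ Icc 0 y, HasDerivWithinAt (fun x => (f x)⁻¹) (-fp x / f x ^ 2) (Icc 0 y) x :=
    fun x hx => (h1 x hx).fun_inv (h0 x hx)
  have := norm_le_gronwallBound_of_norm_deriv_right_le (f := fun x => (f x)⁻¹) (f' := fun x => -fp x / f x ^ 2)
    (a := 0) (b := y) (δ := ‖(f 0)⁻¹‖) (K := ‖fp 0 / f 0‖ + Lam) (ε := 0)
    (fun x hx => (hinv x hx).continuousWithinAt)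
    (fun x hx => (hinv x ⟨hx.1, hx.2.le⟩).mono_of_mem_nhdsWithin (Icc_mem_nhdsGE_of_mem hx)) le_rfl
    (by
      intro x hx
      have h3 := hLb x ⟨hx.1, hx.2.le⟩
      have : -fp x / f x ^ 2 = -(fp x / f x * (f x)⁻¹) := by
        have := h0 x ⟨hx.1, hx.2.le⟩
        field_simp
      rw [this, norm_neg, norm_mul, add_zero]
      gcongr) y ⟨hy0, le_rfl⟩
  rw [gronwallBound_ε0] at this
  refine this.trans ?_
  gcongr
  have : 0 ≤ ‖fp 0 / f 0‖ := norm_nonneg _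
  nlinarith

lemma aux_ode (b : ℝ) (hb1 : b ≤ 1) (f fp fpp : ℝ → ℂ)
    (h1 : ∀ x ∈ Icc 0 b, HasDerivWithinAt f (fp x) (Icc 0 b) x)
    (h2 : ∀ x ∈ Icc 0 b, HasDerivWithinAt fp (fpp x) (Icc 0 b) x) (Lam : ℝ)
    (hg : ∀ x ∈ Icc 0 b, ‖(fpp x * f x - fp x ^ 2) / f x ^ 2‖ ≤ Lam)
    (h0 : f 0 ≠ 0) :
    ∀ x ∈ Icc 0 b, f x ≠ 0 ∧ ‖(f x)⁻¹‖ ≤ ‖(f 0)⁻¹‖ * Real.exp (‖fp 0 / f 0‖ + Lam) := by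
  have hseg : ∀ y, 0 ≤ y → y ≤ b → (∀ x ∈ Icc 0 y, f x ≠ 0) →
      ‖(f y)⁻¹‖ ≤ ‖(f 0)⁻¹‖ * Real.exp (‖fp 0 / f 0‖ + Lam) := by
    intro y hy0 hyb hne
    have hsub : Icc 0 y ⊆ Icc 0 b := Icc_subset_Icc_right hyb
    exact aux_ode_seg y hy0 (hyb.trans hb1) f fp fpp (fun x hx => (h1 x (hsub hx)).mono hsub)
      (fun x hx => (h2 x (hsub hx)).mono hsub) Lam (fun x hx => hg x (hsub hx)) hne
  have hcont : ContinuousOn f (Icc 0 b) := fun x hx => (h1 x hx).continuousWithinAt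
  have hne : ∀ x ∈ Icc 0 b, f x ≠ 0 := by
    by_contra! hcon
    obtain ⟨x₀, hx₀, hfx₀⟩ := hcon
    have hclosed : IsClosed (Icc 0 b ∩ f ⁻¹' {0}) := hcont.preimage_isClosed_of_isClosed isClosed_Icc isClosed_singleton
    have hcomp : IsCompact (Icc 0 b ∩ f ⁻¹' {0}) := isCompact_Icc.of_isClosed_subset hclosed inter_subset_left
    obtain ⟨z, hz, hmin⟩ := hcomp.exists_isLeast ⟨x₀, hx₀, hfx₀⟩
    have hz0 : 0 < z := lt_of_le_of_ne hz.1.1 (fun h => h0 (by rw [h]; exact hz.2))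
    set C := ‖(f 0)⁻¹‖ * Real.exp (‖fp 0 / f 0‖ + Lam) with hC
    have hC0 : 0 < C := by
      have : 0 < ‖(f 0)⁻¹‖ := norm_pos_iff.2 (inv_ne_zero h0)
      positivity
    have hlow : ∀ x ∈ Ico 0 z, C⁻¹ ≤ ‖f x‖ := by
      intro x hx
      have hnx : ∀ t ∈ Icc 0 x, f t ≠ 0 := by
        intro t ht h
        have := hmin ⟨⟨ht.1, ht.2.trans (hx.2.le.trans hz.1.2)⟩, h⟩
        linarith [ht.2, hx.2]
      have h3 := hseg x hx.1 (hx.2.le.trans hz.1.2) hnx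
      rw [norm_inv] at h3
      have h4 : 0 < ‖f x‖ := norm_pos_iff.2 (hnx x ⟨hx.1, le_rfl⟩)
      exact inv_le_of_inv_le₀ h4 h3
    have hlim : Filter.Tendsto (fun x => ‖f x‖) (nhdsWithin z (Ico 0 z)) (nhds ‖f z‖) :=
      ((hcont z hz.1).mono (fun x hx => ⟨hx.1, hx.2.le.trans hz.1.2⟩)).norm
    have hneb : (nhdsWithin z (Ico 0 z)).NeBot := by
      rw [← mem_closure_iff_nhdsWithin_neBot, closure_Ico hz0.ne]
      exact ⟨hz0.le, le_rfl⟩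
    have h5 := ge_of_tendsto hlim (Filter.eventually_of_mem self_mem_nhdsWithin hlow)
    have h6 : f z = 0 := hz.2
    rw [h6, norm_zero] at h5
    exact absurd h5 (not_le.2 (inv_pos.2 hC0))
  exact fun x hx => ⟨hne x hx, hseg x hx.1 hx.2 (fun t ht => hne t ⟨ht.1, ht.2.trans hx.2⟩)⟩

lemma aux_ode_zero (f fp fpp : ℝ → ℂ)
    (h1 : ∀ x ∈ Icc (0 : ℝ) 1, HasDerivWithinAt f (fp x) (Icc 0 1) x)
    (h2 : ∀ x ∈ Icc (0 : ℝ) 1, HasDerivWithinAt fp (fpp x) (Icc 0 1) x) (Lam : ℝ)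
    (hg : ∀ x ∈ Icc (0 : ℝ) 1, ‖(fpp x * f x - fp x ^ 2) / f x ^ 2‖ ≤ Lam)
    (h0 : f 0 = 0) : ∀ y ∈ Icc (0 : ℝ) 1, f y = 0 := by
  intro y hy
  by_contra hne
  have hmaps : MapsTo (fun s => y - s) (Icc 0 y) (Icc (0 : ℝ) 1) := by
    intro s hs
    exact ⟨by linarith [hs.2], by linarith [hs.1, hy.2]⟩
  have hsub : ∀ s, HasDerivWithinAt (fun s => y - s) (-1) (Icc 0 y) s := by
    intro s
    exact ((hasDerivAt_id s).const_sub y).hasDerivWithinAt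
  have := aux_ode y hy.2 (fun s => f (y - s)) (fun s => -fp (y - s)) (fun s => fpp (y - s)) ?_ ?_ Lam ?_
    (by simpa using hne) y ⟨hy.1, le_rfl⟩
  · apply this.1; simpa using h0
  · intro s hs
    have := (h1 _ (hmaps hs)).scomp s (hsub s) hmaps
    simpa [Function.comp_def] using this
  · intro s hs
    have := ((h2 _ (hmaps hs)).scomp s (hsub s) hmaps).fun_neg
    simpa [Function.comp_def] using this
  · intro s hs
    have := hg _ (hmaps hs)
    simpa using this

lemma aux_bump (m : ℕ) : ∃ (B : ℝ) (φ : ℝ → ℝ), 1 ≤ B ∧ (∀ j : ℕ, ContDiff ℝ j φ) ∧ φ 0 = 1 ∧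
    (∀ j ≤ m + 1, ∀ x, |iteratedDeriv j φ x| ≤ B) ∧
    (∀ j, ∀ x, 1 / 2 ≤ |x| → iteratedDeriv j φ x = 0) := by
  let β : ContDiffBump (0 : ℝ) := ⟨1 / 4, 1 / 3, by norm_num, by norm_num⟩
  have hcd : ∀ j : ℕ, ContDiff ℝ j (β : ℝ → ℝ) := fun j => β.contDiff
  have hzero : ∀ j, ∀ x : ℝ, 1 / 2 ≤ |x| → iteratedDeriv j (β : ℝ → ℝ) x = 0 := by
    intro j x hx
    have hev : (β : ℝ → ℝ) =ᶠ[nhds x] fun _ => (0 : ℝ) := by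
      have hopen : {y : ℝ | 1 / 3 < |y|} ∈ nhds x :=
        (isOpen_lt continuous_const continuous_abs).mem_nhds (by change 1 / 3 < |x|; linarith)
      filter_upwards [hopen] with y hy
      apply β.zero_of_le_dist
      rw [Real.dist_eq, sub_zero]
      exact le_of_lt hy
    rw [hev.iteratedDeriv_eq]
    simp
  have hbd : ∀ j, ∃ B, ∀ x, |iteratedDeriv j (β : ℝ → ℝ) x| ≤ B := by
    intro j
    have hc : Continuous (iteratedDeriv j (β : ℝ → ℝ)) := (hcd j).continuous_iteratedDeriv' j
    obtain ⟨B, hB⟩ := (isCompact_Icc (a := (-1 / 2 : ℝ)) (b := 1 / 2)).exists_bound_of_continuousOn hc.continuousOn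
    refine ⟨max B 0, fun x => ?_⟩
    by_cases hx : 1 / 2 ≤ |x|
    · rw [hzero j x hx]; simp
    · push Not at hx
      rw [abs_lt] at hx
      exact (hB x ⟨by linarith, by linarith⟩).trans (le_max_left _ _)
  choose Bf hBf using hbd
  have hBf0 : ∀ j, 0 ≤ Bf j := fun j => (abs_nonneg _).trans (hBf j 0)
  refine ⟨1 + ∑ j ∈ Finset.range (m + 2), Bf j, β, ?_, hcd, ?_, ?_, hzero⟩
  · linarith [Finset.sum_nonneg (fun j (_ : j ∈ Finset.range (m + 2)) => hBf0 j)]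
  · apply β.one_of_mem_closedBall
    simp [β]
  · intro j hj x
    have := Finset.single_le_sum (fun j (_ : j ∈ Finset.range (m + 2)) => hBf0 j)
      (Finset.mem_range.2 (by omega : j < m + 2))
    linarith [hBf j x]

/-- Real sign. -/
def sgR (b : Bool) : ℝ := if b then 1 else -1

lemma sgR_abs (b : Bool) : |sgR b| = 1 := by cases b <;> simp [sgR]

lemma sgR_cast (b : Bool) : ((sgR b : ℝ) : ℂ) = sgB b := by cases b <;> simp [sgR, sgB]

lemma aux_holder (m : ℕ) (α : ℝ) (hα0 : 0 < α) (hα1 : α ≤ 1) :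
    ∃ c : ℝ, 0 < c ∧ c ≤ 1 ∧ ∀ n : ℕ, 1 ≤ n → ∀ σ : Fin n → Bool, ∃ h : ℝ → ℝ,
      HolderClass1 m α h ∧ (∀ x ∈ Icc (0 : ℝ) (1 / 20), h x = 0) ∧
      ∀ i : Fin n, h (1 / 2 + ((i : ℕ) + 1 / 2) / (2 * n)) = sgR (σ i) * (c / (2 * (n : ℝ)) ^ ((m : ℝ) + α)) := by
  obtain ⟨B, φ, hB1, hcd, hφ0, hφB, hφz⟩ := aux_bump m
  have hB0 : 0 < B := by linarith
  have hφz0 : ∀ x, 1 / 2 ≤ |x| → φ x = 0 := fun x hx => by simpa using hφz 0 x hx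
  refine ⟨1 / (2 * B), by positivity, by rw [div_le_one (by positivity)]; linarith, ?_⟩
  intro n hn σ
  have hnr : (1 : ℝ) ≤ n := by exact_mod_cast hn
  set s : ℝ := 2 * (n : ℝ) with hs
  have hs1 : 1 ≤ s := by linarith
  have hs0 : 0 < s := by linarith
  set l : ℝ := (m : ℝ) + α with hl
  set Φ : ℝ → ℝ := fun y => ∑ i : Fin n, sgR (σ i) * φ (y - (n + (i : ℕ) + 1 / 2)) with hΦ
  set κ := 1 / (2 * B) / s ^ l with hκ
  have hsl : 0 < s ^ l := Real.rpow_pos_of_pos hs0 _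
  have hκ0 : 0 < κ := by positivity
  have hφt : ∀ (j : ℕ) (t : ℝ), ContDiff ℝ j (fun y => φ (y - t)) :=
    fun j t => (hcd j).comp (contDiff_id.sub contDiff_const)
  have hΦcd : ∀ j : ℕ, ContDiff ℝ j Φ := by
    intro j
    apply ContDiff.sum
    intro i _
    exact contDiff_const.mul (hφt j _)
  have hΦd : ∀ j y, iteratedDeriv j Φ y = ∑ i : Fin n, sgR (σ i) * iteratedDeriv j φ (y - (n + (i : ℕ) + 1 / 2)) := by
    intro j y
    rw [hΦ, iteratedDeriv_fun_sum]
    · apply Finset.sum_congr rfl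
      intro i _
      rw [iteratedDeriv_const_mul _ (hφt j _).contDiffAt, iteratedDeriv_comp_sub_const]
    · intro i _
      exact (contDiff_const.mul (hφt j _)).contDiffAt
  have hΦb : ∀ j ≤ m + 1, ∀ y, |iteratedDeriv j Φ y| ≤ B := by
    intro j hj y
    rw [hΦd]
    by_cases hex : ∃ i : Fin n, |y - (n + (i : ℕ) + 1 / 2)| < 1 / 2
    · obtain ⟨i, hi⟩ := hex
      rw [Finset.sum_eq_single_of_mem i (Finset.mem_univ _)]
      · rw [abs_mul, sgR_abs, one_mul]; exact hφB j hj _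
      · intro k _ hk
        rw [hφz, mul_zero]
        by_contra! hcon
        rw [abs_lt] at hi hcon
        apply hk
        have h1 : ((k : ℕ) : ℝ) < (i : ℕ) + 1 := by linarith
        have h2 : ((i : ℕ) : ℝ) < (k : ℕ) + 1 := by linarith
        have h1' : (k : ℕ) < (i : ℕ) + 1 := by exact_mod_cast h1
        have h2' : (i : ℕ) < (k : ℕ) + 1 := by exact_mod_cast h2
        exact Fin.ext (by omega)
    · push Not at hex
      rw [Finset.sum_eq_zero]
      · simpa using hB0.le
      · intro i _
        rw [hφz _ _ (hex i), mul_zero]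
  have hlip : ∀ x y, |iteratedDeriv m Φ x - iteratedDeriv m Φ y| ≤ B * |x - y| := by
    intro x y
    have hdiff : Differentiable ℝ (iteratedDeriv m Φ) := (hΦcd (m + 1)).differentiable_iteratedDeriv m (by exact_mod_cast Nat.lt_succ_self m)
    have := Convex.norm_image_sub_le_of_norm_deriv_le (f := iteratedDeriv m Φ) (s := univ) (x := y) (y := x) (C := B)
      (fun x _ => hdiff x) (fun x _ => by
        rw [← iteratedDeriv_succ, Real.norm_eq_abs]; exact hΦb (m + 1) le_rfl x) convex_univ (mem_univ _) (mem_univ _)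
    simpa [Real.norm_eq_abs] using this
  set h : ℝ → ℝ := fun x => κ * Φ (s * x) with hh
  have hscd : ∀ j : ℕ, ContDiff ℝ j (fun x => Φ (s * x)) := fun j => (hΦcd j).comp (contDiff_const.mul contDiff_id)
  have hhcd : ∀ j : ℕ, ContDiff ℝ j h := fun j => contDiff_const.mul (hscd j)
  have hhd : ∀ j, ∀ x ∈ I01, iteratedDerivWithin j h I01 x = κ * (s ^ j * iteratedDeriv j Φ (s * x)) := by
    intro j x hx
    rw [iteratedDerivWithin_eq_iteratedDeriv (show UniqueDiffOn ℝ I01 from uniqueDiffOn_Icc (by norm_num)) (hhcd j).contDiffAt hx, hh,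
      iteratedDeriv_const_mul _ (hscd j).contDiffAt, iteratedDeriv_comp_const_mul (hΦcd j)]
  have hκs : ∀ j ≤ m, κ * s ^ j ≤ 1 / (2 * B) := by
    intro j hj
    have : s ^ j ≤ s ^ l := by
      rw [← Real.rpow_natCast]
      apply Real.rpow_le_rpow_of_exponent_le hs1
      have : (j : ℝ) ≤ m := by exact_mod_cast hj
      linarith
    rw [hκ, div_mul_eq_mul_div, div_le_iff₀ hsl]
    gcongr
  refine ⟨h, ⟨(hhcd m).contDiffOn, ?_, ?_⟩, ?_, ?_⟩
  · intro j hj x hx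
    rw [hhd j x hx, ← mul_assoc, abs_mul, abs_of_pos (by positivity : 0 < κ * s ^ j)]
    calc κ * s ^ j * |iteratedDeriv j Φ (s * x)| ≤ 1 / (2 * B) * B := by
          gcongr
          · exact hκs j hj
          · exact hΦb j (by omega) _
      _ ≤ 1 := by
          have : 1 / (2 * B) * B = 1 / 2 := by field_simp
          rw [this]; norm_num
  · intro x hx y hy
    rw [hhd m x hx, hhd m y hy, ← mul_sub, ← mul_sub, ← mul_assoc, abs_mul, abs_of_pos (by positivity : 0 < κ * s ^ m)]
    have hkey : |iteratedDeriv m Φ (s * x) - iteratedDeriv m Φ (s * y)| ≤ 2 * B * (s * |x - y|) ^ α := by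
      have hz0 : 0 ≤ s * |x - y| := by positivity
      rcases le_total (s * |x - y|) 1 with hle | hge
      · have h1 := hlip (s * x) (s * y)
        rw [← mul_sub, abs_mul, abs_of_pos hs0] at h1
        have h2 : s * |x - y| ≤ (s * |x - y|) ^ α := by
          rcases hz0.eq_or_lt with h | h
          · rw [← h, Real.zero_rpow hα0.ne']
          · conv_lhs => rw [← Real.rpow_one (s * |x - y|)]
            exact Real.rpow_le_rpow_of_exponent_ge h hle hα1
        nlinarith
      · have h1 : |iteratedDeriv m Φ (s * x) - iteratedDeriv m Φ (s * y)| ≤ 2 * B := by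
          refine (abs_sub _ _).trans ?_
          linarith [hΦb m (by omega) (s * x), hΦb m (by omega) (s * y)]
        have h2 : 1 ≤ (s * |x - y|) ^ α := Real.one_le_rpow hge hα0.le
        nlinarith
    calc κ * s ^ m * |iteratedDeriv m Φ (s * x) - iteratedDeriv m Φ (s * y)|
        ≤ κ * s ^ m * (2 * B * (s * |x - y|) ^ α) := by gcongr
      _ = |x - y| ^ α := by
          rw [Real.mul_rpow hs0.le (abs_nonneg _), hκ, hl, Real.rpow_add hs0, Real.rpow_natCast]
          have : 0 < s ^ α := Real.rpow_pos_of_pos hs0 _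
          field_simp
  · intro x hx
    have : Φ (s * x) = 0 := by
      apply Finset.sum_eq_zero
      intro i _
      rw [hφz0, mul_zero]
      have h1 : s * x ≤ n := by rw [hs]; nlinarith [hx.2]
      have h2 : (0 : ℝ) ≤ (i : ℕ) := Nat.cast_nonneg _
      rw [abs_of_nonpos (by linarith)]
      linarith
    simp [hh, this]
  · intro i
    have harg : s * (1 / 2 + ((i : ℕ) + 1 / 2) / s) = n + (i : ℕ) + 1 / 2 := by
      field_simp
      rw [hs]; ring
    have : Φ (n + (i : ℕ) + 1 / 2) = sgR (σ i) := by
      simp only [hΦ]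
      rw [Finset.sum_eq_single_of_mem i (Finset.mem_univ _)]
      · rw [sub_self, hφ0, mul_one]
      · intro k _ hk
        rw [hφz0, mul_zero]
        by_contra! hcon
        rw [abs_lt] at hcon
        apply hk
        have h1 : ((k : ℕ) : ℝ) < (i : ℕ) + 1 := by linarith
        have h2 : ((i : ℕ) : ℝ) < (k : ℕ) + 1 := by linarith
        have h1' : (k : ℕ) < (i : ℕ) + 1 := by exact_mod_cast h1
        have h2' : (i : ℕ) < (k : ℕ) + 1 := by exact_mod_cast h2
        exact Fin.ext (by omega)
    simp only [hh]
    rw [harg, this, mul_comm]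

/-- Nonnegative and polynomially bounded on `[1,∞)`. -/
def PB (f : ℝ → ℝ) : Prop := ∃ (C : ℝ) (p : ℕ), 0 ≤ C ∧ ∀ x, 1 ≤ x → 0 ≤ f x ∧ f x ≤ C * x ^ p

lemma PB.const {c : ℝ} (hc : 0 ≤ c) : PB (fun _ => c) := ⟨c, 0, hc, fun x _ => ⟨hc, by simp⟩⟩

lemma PB.id : PB (fun x => x) := ⟨1, 1, zero_le_one, fun x hx => ⟨by linarith, by simp⟩⟩

lemma PB.add {f g : ℝ → ℝ} (hf : PB f) (hg : PB g) : PB (fun x => f x + g x) := by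
  obtain ⟨C, p, hC, hf⟩ := hf
  obtain ⟨D, r, hD, hg⟩ := hg
  refine ⟨C + D, p + r, by positivity, fun x hx => ⟨add_nonneg (hf x hx).1 (hg x hx).1, ?_⟩⟩
  have h1 : x ^ p ≤ x ^ (p + r) := pow_le_pow_right₀ hx (by omega)
  have h2 : x ^ r ≤ x ^ (p + r) := pow_le_pow_right₀ hx (by omega)
  have h3 := (hf x hx).2
  have h4 := (hg x hx).2
  have h5 : C * x ^ p ≤ C * x ^ (p + r) := by gcongr
  have h6 : D * x ^ r ≤ D * x ^ (p + r) := by gcongr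
  rw [add_mul]; linarith

lemma PB.mul {f g : ℝ → ℝ} (hf : PB f) (hg : PB g) : PB (fun x => f x * g x) := by
  obtain ⟨C, p, hC, hf⟩ := hf
  obtain ⟨D, r, hD, hg⟩ := hg
  refine ⟨C * D, p + r, by positivity, fun x hx => ⟨mul_nonneg (hf x hx).1 (hg x hx).1, ?_⟩⟩
  calc f x * g x ≤ (C * x ^ p) * (D * x ^ r) :=
        mul_le_mul (hf x hx).2 (hg x hx).2 (hg x hx).1 (by positivity)
    _ = _ := by rw [pow_add]; ring

lemma PB.rpow {f : ℝ → ℝ} (hf : PB f) {d : ℝ} (hd : 0 ≤ d) : PB (fun x => f x ^ d) := by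
  obtain ⟨C, p, hC, hf⟩ := hf
  refine ⟨C ^ d, ⌈(p : ℝ) * d⌉₊, by positivity, fun x hx => ⟨Real.rpow_nonneg (hf x hx).1 _, ?_⟩⟩
  have hx0 : 0 ≤ x := by linarith
  calc f x ^ d ≤ (C * x ^ p) ^ d := Real.rpow_le_rpow (hf x hx).1 (hf x hx).2 hd
    _ = C ^ d * x ^ ((p : ℝ) * d) := by
        rw [Real.mul_rpow hC (by positivity), ← Real.rpow_natCast, ← Real.rpow_mul hx0]
    _ ≤ C ^ d * x ^ ((⌈(p : ℝ) * d⌉₊ : ℕ) : ℝ) := by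
        gcongr
        exact Nat.le_ceil _
    _ = _ := by rw [Real.rpow_natCast]

lemma aux_choose (C : ℝ) (hC : 0 < C) (p : ℕ) : ∃ C₂ : ℝ, 0 < C₂ ∧ ∀ P : ℕ, 2 ≤ P → ∃ n : ℕ, P ≤ n ∧
    (n : ℝ) ≤ C₂ * (P * Real.log P) ∧ 2 * (C * (n : ℝ) ^ p) ^ P < 2 ^ n := by
  obtain ⟨T, hT⟩ : ∃ T : ℕ, 1 ≤ T ∧ 2 * p ≤ T ∧ 2 * C * (T : ℝ) ^ p * 2 ^ (2 * p) < 2 ^ T := by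
    have h := tendsto_pow_const_div_const_pow_of_one_lt p (r := (2 : ℝ)) (by norm_num)
    have h2 := h.eventually (gt_mem_nhds (show (0 : ℝ) < 1 / (2 * C * 2 ^ (2 * p)) by positivity))
    obtain ⟨T, hT1, hT2⟩ := (h2.and (Filter.eventually_ge_atTop (2 * p + 1))).exists
    refine ⟨T, by omega, by omega, ?_⟩
    rw [div_lt_div_iff₀ (by positivity) (by positivity)] at hT1
    linarith
  obtain ⟨hT1, hTp, hT⟩ := hT
  have hTr : (1 : ℝ) ≤ T := by exact_mod_cast hT1
  have hlog2 : 0 < Real.log 2 := Real.log_pos (by norm_num)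
  refine ⟨2 * T / Real.log 2, by positivity, ?_⟩
  intro P hP
  set L := Nat.log 2 P + 1 with hL
  have hPL : P < 2 ^ L := Nat.lt_pow_succ_log_self (by norm_num) P
  have hL1 : 1 ≤ L := by omega
  refine ⟨T * P * L, ?_, ?_, ?_⟩
  · calc P = 1 * P * 1 := by ring
      _ ≤ T * P * L := by gcongr
  · have hlog : (Nat.log 2 P : ℝ) * Real.log 2 ≤ Real.log P := by
      rw [← Real.log_pow]
      apply Real.log_le_log (by positivity)
      exact_mod_cast Nat.pow_log_le_self 2 (by omega : P ≠ 0)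
    have hlogP : Real.log 2 ≤ Real.log P := Real.log_le_log (by norm_num) (by exact_mod_cast hP)
    have hLr : (L : ℝ) * Real.log 2 ≤ 2 * Real.log P := by
      rw [hL]; push_cast; linarith
    push_cast
    have : 2 * (T : ℝ) / Real.log 2 * (P * Real.log P) = T * P * (2 * Real.log P) / Real.log 2 := by ring
    rw [this, le_div_iff₀ hlog2, mul_assoc]
    gcongr
  · have hLn : (L : ℝ) ≤ 2 ^ L := by exact_mod_cast Nat.lt_two_pow_self.le
    have hPr : (P : ℝ) ≤ 2 ^ L := by exact_mod_cast hPL.le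
    have hnle : ((T * P * L : ℕ) : ℝ) ≤ T * 2 ^ (2 * L) := by
      push_cast
      calc (T : ℝ) * P * L ≤ T * 2 ^ L * 2 ^ L := by gcongr
        _ = _ := by rw [two_mul, pow_add]; ring
    have hstep : 2 * C * ((T * P * L : ℕ) : ℝ) ^ p < 2 ^ (T * L) := by
      calc 2 * C * ((T * P * L : ℕ) : ℝ) ^ p ≤ 2 * C * (T * 2 ^ (2 * L)) ^ p := by gcongr
        _ = 2 * C * (T : ℝ) ^ p * 2 ^ (2 * p * L) := by rw [mul_pow, ← pow_mul]; ring_nf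
        _ = (2 * C * (T : ℝ) ^ p * 2 ^ (2 * p)) * 2 ^ (2 * p * (L - 1)) := by
            rw [mul_assoc (2 * C * (T : ℝ) ^ p), ← pow_add]
            congr 2
            obtain ⟨L', hL'⟩ : ∃ L', L = L' + 1 := ⟨L - 1, by omega⟩
            rw [hL']; simp; ring
        _ < 2 ^ T * 2 ^ (2 * p * (L - 1)) := by gcongr
        _ ≤ 2 ^ T * 2 ^ (T * (L - 1)) := by
            gcongr
            norm_num
        _ = 2 ^ (T * L) := by
            rw [← pow_add]
            congr 1
            obtain ⟨L', hL'⟩ : ∃ L', L = L' + 1 := ⟨L - 1, by omega⟩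
            rw [hL']; simp; ring
    calc 2 * (C * ((T * P * L : ℕ) : ℝ) ^ p) ^ P ≤ 2 ^ P * (C * ((T * P * L : ℕ) : ℝ) ^ p) ^ P := by
          gcongr
          exact le_self_pow₀ (by norm_num) (by omega)
      _ = (2 * C * ((T * P * L : ℕ) : ℝ) ^ p) ^ P := by rw [← mul_pow]; ring_nf
      _ < (2 ^ (T * L)) ^ P := by
          apply pow_lt_pow_left₀ hstep (by positivity) (by omega)
      _ = 2 ^ (T * P * L) := by rw [← pow_mul]; ring_nf

lemma aux_final (q : ℝ) (hq0 : 0 < q) (hq1 : q < 1) (X : ℝ → ℝ) (hX : PB X) :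
    ∃ C₂ : ℝ, 0 < C₂ ∧ ∀ P : ℕ, 2 ≤ P → ∃ n K : ℕ, P ≤ n ∧ 0 < K ∧
      (n : ℝ) ≤ C₂ * (P * Real.log P) ∧ 2 * K ^ P < 2 ^ n ∧
      (2 : ℝ) ^ n * (P * (1 / (1 - q)) ^ P * ((1 + 1 / (1 - q)) * ((2 * Real.exp (X n)) ^ n) ^ n * q ^ K * (1 / (1 - q))))
      ≤ 1 / 4 * ((Real.exp (- X n)) ^ n) ^ n := by
  have hq' : 0 < 1 - q := by linarith
  set G := 1 / (1 - q) with hG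
  have hG1 : 1 ≤ G := by rw [hG, le_div_iff₀ hq']; linarith
  have ha : 0 < - Real.log q := by linarith [Real.log_neg hq0 hq1]
  set a := - Real.log q with ha'
  have hY : PB (fun x => (2 + 2 * x + G * x + 2 * G + x * x * (1 + 2 * X x)) * a⁻¹ + 2) := by
    have h2 : PB (fun _ => (2 : ℝ)) := PB.const (by norm_num)
    have hGc : PB (fun _ => G) := PB.const (by linarith)
    exact (((((h2.add (h2.mul PB.id)).add (hGc.mul PB.id)).add (h2.mul hGc)).add
      ((PB.id.mul PB.id).mul ((PB.const zero_le_one).add (h2.mul hX)))).mul (PB.const (by positivity))).add h2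
  obtain ⟨C, p, hC, hCp⟩ := hY
  obtain ⟨C₂, hC₂, hch⟩ := aux_choose (C + 1) (by linarith) p
  refine ⟨C₂, hC₂, fun P hP => ?_⟩
  obtain ⟨n, hPn, hn2, hpow⟩ := hch P hP
  have hn1 : (1 : ℝ) ≤ n := by exact_mod_cast (by omega : 1 ≤ n)
  have hPnr : (P : ℝ) ≤ n := by exact_mod_cast hPn
  obtain ⟨hYn0, hYn⟩ := hCp n hn1
  set Y := 2 + 2 * (n : ℝ) + G * n + 2 * G + n * n * (1 + 2 * X n) with hYdef
  have hXn0 : 0 ≤ X n := by obtain ⟨_, _, _, h⟩ := hX; exact (h n hn1).1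
  have hY0 : 0 ≤ Y := by positivity
  refine ⟨n, ⌈Y * a⁻¹⌉₊ + 1, hPn, by omega, hn2, ?_, ?_⟩
  · have hK : ((⌈Y * a⁻¹⌉₊ + 1 : ℕ) : ℝ) ≤ (C + 1) * (n : ℝ) ^ p := by
      have := Nat.ceil_lt_add_one (by positivity : 0 ≤ Y * a⁻¹)
      push_cast
      have h3 : (0 : ℝ) ≤ (n : ℝ) ^ p := by positivity
      linarith
    have : (2 : ℝ) * ((⌈Y * a⁻¹⌉₊ + 1 : ℕ) : ℝ) ^ P < 2 ^ n := lt_of_le_of_lt (by gcongr) hpow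
    exact_mod_cast this
  · set K := ⌈Y * a⁻¹⌉₊ + 1 with hK
    have hKa : Y ≤ K * a := by
      have h1 : Y * a⁻¹ ≤ K := by
        rw [hK]; push_cast
        linarith [Nat.le_ceil (Y * a⁻¹)]
      calc Y = Y * a⁻¹ * a := by field_simp
        _ ≤ _ := by gcongr
    have h2e : (2 : ℝ) ≤ Real.exp 1 := by linarith [Real.add_one_le_exp (1 : ℝ)]
    have e1 : (2 : ℝ) ^ n ≤ Real.exp n := by
      calc (2 : ℝ) ^ n ≤ (Real.exp 1) ^ n := by gcongr
        _ = _ := by rw [← Real.exp_nat_mul, mul_one]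
    have e2 : (P : ℝ) ≤ Real.exp n := by linarith [Real.add_one_le_exp (n : ℝ)]
    have e3 : G ≤ Real.exp G := by linarith [Real.add_one_le_exp G]
    have e3' : 1 + G ≤ Real.exp G := by linarith [Real.add_one_le_exp G]
    have e4 : G ^ P ≤ Real.exp (G * n) := by
      calc G ^ P ≤ G ^ n := pow_le_pow_right₀ hG1 hPn
        _ ≤ (Real.exp G) ^ n := by gcongr
        _ = _ := by rw [← Real.exp_nat_mul]; ring_nf
    have e5 : ((2 * Real.exp (X n)) ^ n) ^ n ≤ Real.exp (n * n * (1 + X n)) := by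
      calc ((2 * Real.exp (X n)) ^ n) ^ n ≤ ((Real.exp 1 * Real.exp (X n)) ^ n) ^ n := by gcongr
        _ = _ := by rw [← Real.exp_add, ← Real.exp_nat_mul, ← Real.exp_nat_mul]; ring_nf
    have e6 : q ^ K = Real.exp (-(K * a)) := by
      rw [ha', ← Real.rpow_natCast, Real.rpow_def_of_pos hq0]; ring_nf
    have e7 : ((Real.exp (- X n)) ^ n) ^ n = Real.exp (-(n * n * X n)) := by
      rw [← Real.exp_nat_mul, ← Real.exp_nat_mul]; ring_nf
    have e8 : Real.exp (-2) ≤ 1 / 4 := by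
      have : Real.exp (-2) = (Real.exp 1 * Real.exp 1)⁻¹ := by
        rw [← Real.exp_add, ← Real.exp_neg]; norm_num
      rw [this, one_div]
      apply inv_anti₀ (by norm_num)
      nlinarith
    rw [e6, e7]
    have hG0 : 0 ≤ G := by linarith
    calc _ ≤ Real.exp n * (Real.exp n * Real.exp (G * n) * (Real.exp G * Real.exp (n * n * (1 + X n)) *
            Real.exp (-(K * a)) * Real.exp G)) := by gcongr
      _ = Real.exp (n + (n + G * n + (G + n * n * (1 + X n) + -(K * a) + G))) := by
          simp only [Real.exp_add]
      _ ≤ Real.exp (-2 + -(n * n * X n)) := by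
          apply Real.exp_le_exp.2
          rw [hYdef] at hKa
          linarith
      _ ≤ _ := by
          rw [Real.exp_add]; gcongr

/-- Scaled `ζ`-coordinates. -/
def zmap (N M : ℕ) (r : ℝ) (z : Fin (N + M) → ℂ) : Fin N → ℂ := fun j => (r : ℂ) * z (Fin.castAdd M j)

/-- Scaled `w`-coordinates. -/
def wmap (N M : ℕ) (ρ : ℝ) (a : Fin M → ℝ) (z : Fin (N + M) → ℂ) : Fin M → ℂ :=
  fun i => (a i : ℂ) + ((ρ * a i : ℝ) : ℂ) * z (Fin.natAdd N i)

lemma wmap_mem (N M : ℕ) (ρ R : ℝ) (a : Fin M → ℝ) (ha : ∀ i, 0 < a i) (hρ : 0 ≤ ρ) (hρR : ρ * R < 1)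
    (z : Fin (N + M) → ℂ) (hz : ∀ i, ‖z i‖ ≤ R) : wmap N M ρ a z ∈ Wset M := by
  intro i
  have h1 := hz (Fin.natAdd N i)
  have h2 := (abs_le.1 (Complex.abs_re_le_norm (z (Fin.natAdd N i)))).1
  simp only [wmap, Complex.add_re, Complex.ofReal_re, Complex.re_ofReal_mul]
  have h3 : -R ≤ (z (Fin.natAdd N i)).re := by linarith
  have h4 := mul_le_mul_of_nonneg_left h3 (mul_nonneg hρ (ha i).le)
  nlinarith [ha i]

lemma diff_update {P : ℕ} (z : Fin P → ℂ) (i k : Fin P) : Differentiable ℂ (fun s => Function.update z i s k) := by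
  by_cases h : k = i
  · subst h; simpa using differentiable_id
  · simp [Function.update_of_ne h]

lemma update_bound {P : ℕ} {R : ℝ} (z : Fin P → ℂ) (hz : ∀ i, ‖z i‖ ≤ R) (i : Fin P) (s : ℂ) (hs : ‖s‖ ≤ R) :
    ∀ k, ‖Function.update z i s k‖ ≤ R := by
  intro k
  by_cases h : k = i
  · subst h; simpa using hs
  · simpa [Function.update_of_ne h] using hz k

lemma aux_sep {N M : ℕ} {A u v b t d : ℝ} {g : ℝ → (Fin N → ℂ) → (Fin M → ℂ) → ℂ}
    (hg : GoodFamily N M A u v b t d g) (r ρ R : ℝ) (a : Fin M → ℝ) (ha : ∀ i, 0 < a i) (hρ : 0 ≤ ρ)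
    (hρR : ρ * R < 1) (x : ℝ) (hx : x ∈ I01) :
    SepHol R (N + M) (fun z => g x (zmap N M r z) (wmap N M ρ a z)) := by
  intro z hz i
  obtain ⟨-, hζ, hw, -⟩ := hg
  have hzd : Differentiable ℂ (fun s => zmap N M r (Function.update z i s)) := by
    rw [differentiable_pi]
    intro j
    exact (diff_update z i _).const_mul _
  have hwd : Differentiable ℂ (fun s => wmap N M ρ a (Function.update z i s)) := by
    rw [differentiable_pi]
    intro j
    exact ((diff_update z i _).const_mul _).const_add _
  induction i using Fin.addCases with
  | left j =>
    have hc : ∀ s, wmap N M ρ a (Function.update z (Fin.castAdd M j) s) = wmap N M ρ a z := by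
      intro s; funext k
      have : Fin.natAdd N k ≠ Fin.castAdd M j := by
        intro h
        have := congrArg Fin.val h
        simp at this
        omega
      simp [wmap, Function.update_of_ne this]
    simp only [hc]
    exact (hζ x hx _ (wmap_mem N M ρ R a ha hρ hρR z hz)).differentiableOn.comp hzd.differentiableOn
      (fun s _ => mem_univ _)
  | right j =>
    have hc : ∀ s, zmap N M r (Function.update z (Fin.natAdd N j) s) = zmap N M r z := by
      intro s; funext k
      have : Fin.castAdd M k ≠ Fin.natAdd N j := by
        intro h
        have := congrArg Fin.val h
        simp at this
        omega
      simp [zmap, Function.update_of_ne this]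
    simp only [hc]
    refine (hw x hx (zmap N M r z)).differentiableOn.comp hwd.differentiableOn ?_
    intro s hs
    exact wmap_mem N M ρ R a ha hρ hρR _ (update_bound z hz _ s (by simpa using hs))

/-- Logarithmic growth bound. -/
def LEf (A u v b t d B₁ r₁ B₂ r₂ : ℝ) (x : ℝ) : ℝ :=
  A + u * x ^ v + b * x ^ t * ((x * (2 * B₁ * x ^ r₁)) ^ d + (x * (2 * B₂ * x ^ r₂)) ^ d)

lemma PB_LEf {A u v b t d B₁ r₁ B₂ r₂ : ℝ} (hA : 1 ≤ A) (hu : 1 ≤ u) (hv : 1 ≤ v) (hb : 1 ≤ b)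
    (ht : 1 ≤ t) (hd : 1 ≤ d) (hB₁ : 1 ≤ B₁) (hB₂ : 1 ≤ B₂) (hr₁ : 1 ≤ r₁) (hr₂ : 1 ≤ r₂) :
    PB (LEf A u v b t d B₁ r₁ B₂ r₂) := by
  have hc : ∀ {c : ℝ}, 1 ≤ c → PB (fun _ => c) := fun h => PB.const (by linarith)
  have hr : ∀ {c : ℝ}, 1 ≤ c → PB (fun x => x ^ c) := fun h => PB.id.rpow (by linarith)
  exact ((hc hA).add ((hc hu).mul (hr hv))).add (((hc hb).mul (hr ht)).mul
    ((PB.rpow (PB.id.mul ((hc (by linarith : (1:ℝ) ≤ 2 * B₁)).mul (hr hr₁))) (by linarith)).add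
     (PB.rpow (PB.id.mul ((hc (by linarith : (1:ℝ) ≤ 2 * B₂)).mul (hr hr₂))) (by linarith))))

lemma aux_bound {N M : ℕ} {A u v b t d B₁ r₁ B₂ r₂ : ℝ} {g : ℝ → (Fin N → ℂ) → (Fin M → ℂ) → ℂ}
    (hg : GoodFamily N M A u v b t d g)
    (hA : 1 ≤ A) (hu : 1 ≤ u) (hv : 1 ≤ v) (hb : 1 ≤ b)
    (ht : 1 ≤ t) (hd : 1 ≤ d) (hB₁ : 1 ≤ B₁) (hB₂ : 1 ≤ B₂) (hr₁ : 1 ≤ r₁) (hr₂ : 1 ≤ r₂)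
    (n : ℝ) (hP1 : 1 ≤ (N : ℝ) + M) (hPn : (N : ℝ) + M ≤ n)
    (r ρ R : ℝ) (hr : 0 ≤ r) (hR : 0 ≤ R) (hrR : r * R ≤ 2 * B₁ * ((N : ℝ) + M) ^ r₁)
    (a : Fin M → ℝ) (ha : ∀ i, 0 < a i ∧ a i ≤ B₂ * ((M : ℝ) + N) ^ r₂) (hρ : 0 ≤ ρ)
    (hρR : ρ * R < 1) (x : ℝ) (hx : x ∈ I01) (z : Fin (N + M) → ℂ) (hz : ∀ i, ‖z i‖ ≤ R) :
    ‖g x (zmap N M r z) (wmap N M ρ a z)‖ ≤ Real.exp (LEf A u v b t d B₁ r₁ B₂ r₂ n) := by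
  have hmem := wmap_mem N M ρ R a (fun i => (ha i).1) hρ hρR z hz
  obtain ⟨-, -, -, hbd⟩ := hg
  refine (hbd (zmap N M r z) _ hmem x hx).trans ?_
  have hn1 : 1 ≤ n := by linarith
  have hPr₁ : ((N : ℝ) + M) ^ r₁ ≤ n ^ r₁ := Real.rpow_le_rpow (by linarith) hPn (by linarith)
  have hPr₂ : ((M : ℝ) + N) ^ r₂ ≤ n ^ r₂ := Real.rpow_le_rpow (by positivity) (by linarith) (by linarith)
  have hNn : (N : ℝ) ≤ n := by linarith [(Nat.cast_nonneg M : (0 : ℝ) ≤ M)]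
  have hMn : (M : ℝ) ≤ n := by linarith [(Nat.cast_nonneg N : (0 : ℝ) ≤ N)]
  have hs1 : ∑ j, ‖zmap N M r z j‖ ≤ n * (2 * B₁ * n ^ r₁) := by
    calc ∑ j, ‖zmap N M r z j‖ ≤ ∑ j : Fin N, (2 * B₁ * n ^ r₁) := by
          apply Finset.sum_le_sum
          intro j _
          simp only [zmap, norm_mul, Complex.norm_real, Real.norm_eq_abs, abs_of_nonneg hr]
          calc r * ‖z (Fin.castAdd M j)‖ ≤ r * R := by gcongr; exact hz _
            _ ≤ 2 * B₁ * ((N : ℝ) + M) ^ r₁ := hrR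
            _ ≤ _ := by gcongr
      _ = N * (2 * B₁ * n ^ r₁) := by simp
      _ ≤ _ := by gcongr
  have hs2 : ∑ i, ‖wmap N M ρ a z i‖ ≤ n * (2 * B₂ * n ^ r₂) := by
    calc ∑ i, ‖wmap N M ρ a z i‖ ≤ ∑ i : Fin M, (2 * B₂ * n ^ r₂) := by
          apply Finset.sum_le_sum
          intro i _
          have ha0 := (ha i).1
          simp only [wmap]
          refine (norm_add_le _ _).trans ?_
          rw [norm_mul, Complex.norm_real, Complex.norm_real, Real.norm_eq_abs, Real.norm_eq_abs,
            abs_of_pos ha0, abs_of_nonneg (by positivity)]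
          have h1 : ρ * a i * ‖z (Fin.natAdd N i)‖ ≤ ρ * a i * R := by gcongr; exact hz _
          have h2 : ρ * a i * R ≤ a i := by nlinarith
          have h3 : a i ≤ B₂ * n ^ r₂ := (ha i).2.trans (by gcongr)
          linarith
      _ = M * (2 * B₂ * n ^ r₂) := by simp
      _ ≤ _ := by gcongr
  have hs10 : 0 ≤ ∑ j, ‖zmap N M r z j‖ := Finset.sum_nonneg (fun _ _ => norm_nonneg _)
  have hs20 : 0 ≤ ∑ i, ‖wmap N M ρ a z i‖ := Finset.sum_nonneg (fun _ _ => norm_nonneg _)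
  have hd0 : 0 ≤ d := by linarith
  have ht0 : 0 ≤ t := by linarith
  have hv0 : 0 ≤ v := by linarith
  have hAe : A ≤ Real.exp A := by linarith [Real.add_one_le_exp A]
  rw [LEf, Real.exp_add, Real.exp_add]
  gcongr

/-- Inverse coordinates of a real parameter point. -/
def ptmap (N M : ℕ) (r ρ : ℝ) (a : Fin M → ℝ) (ζ : Fin N → ℝ) (w : Fin M → ℝ) : Fin (N + M) → ℂ :=
  Fin.append (fun j => ((ζ j / r : ℝ) : ℂ)) (fun i => (((w i - a i) / (ρ * a i) : ℝ) : ℂ))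

lemma ptmap_z {N M : ℕ} {r ρ : ℝ} (a : Fin M → ℝ) (ζ : Fin N → ℝ) (w : Fin M → ℝ) (hr : 0 < r) :
    zmap N M r (ptmap N M r ρ a ζ w) = fun j => (ζ j : ℂ) := by
  funext j
  simp only [zmap, ptmap, Fin.append_left]
  rw [← Complex.ofReal_mul]
  congr 1
  field_simp

lemma ptmap_w {N M : ℕ} {r ρ : ℝ} (a : Fin M → ℝ) (ζ : Fin N → ℝ) (w : Fin M → ℝ) (hρ : 0 < ρ)
    (ha : ∀ i, 0 < a i) :
    wmap N M ρ a (ptmap N M r ρ a ζ w) = fun j => (w j : ℂ) := by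
  funext j
  simp only [wmap, ptmap, Fin.append_right]
  rw [← Complex.ofReal_mul, ← Complex.ofReal_add]
  congr 1
  have := ha j
  field_simp
  ring

lemma ptmap_bound {N M : ℕ} {B₁ r₁ ε q : ℝ} (a : Fin M → ℝ) (ζ : Fin N → ℝ) (w : Fin M → ℝ) (hB₁ : 1 ≤ B₁)
    (hP : 1 ≤ (M : ℝ) + N) (hε : ε < 1) (hq : 0 < q) (ha : ∀ i, 0 < a i) (h : InOmega N M B₁ r₁ ε a ζ w) :
    ∀ k, ‖ptmap N M (B₁ * ((M : ℝ) + N) ^ r₁ / q) ((1 - ε) / q) a ζ w k‖ ≤ q := by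
  have hPr : 0 < ((M : ℝ) + N) ^ r₁ := Real.rpow_pos_of_pos (by linarith) _
  intro k
  induction k using Fin.addCases with
  | left j =>
    simp only [ptmap, Fin.append_left, Complex.norm_real, Real.norm_eq_abs]
    have h1 := h.1 j
    have hp : 0 < B₁ * ((M : ℝ) + N) ^ r₁ / q := by positivity
    rw [abs_div, abs_of_pos hp, div_le_iff₀ hp]
    calc |ζ j| ≤ _ := h1
      _ = _ := by field_simp
  | right j =>
    simp only [ptmap, Fin.append_right, Complex.norm_real, Real.norm_eq_abs]
    have h1 := (h.2 j).2
    have h2 := ha j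
    have h3 : 0 < 1 - ε := by linarith
    have hp : 0 < (1 - ε) / q * a j := by positivity
    rw [abs_div, abs_of_pos hp, div_le_iff₀ hp]
    calc |w j - a j| ≤ _ := h1
      _ = _ := by field_simp

lemma aux_pt (κ β : ℝ) (hβ : 0 < β) (hκ : 0 < κ) (s p k num : ℂ) (hp : p ≠ 0)
    (h : ‖s * (κ : ℂ) - ((1 / β : ℝ) : ℂ) * (k + num / p ^ 2)‖ ≤ κ / 4) :
    ‖(k * p ^ 2 + num) - s * (((κ * β : ℝ) : ℂ) * p ^ 2)‖ ≤ 1 / 4 * ‖((κ * β : ℝ) : ℂ) * p ^ 2‖ := by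
  have hβc : (β : ℂ) ≠ 0 := by exact_mod_cast hβ.ne'
  have e : (k * p ^ 2 + num) - s * (((κ * β : ℝ) : ℂ) * p ^ 2)
      = -((β : ℂ) * p ^ 2) * (s * (κ : ℂ) - ((1 / β : ℝ) : ℂ) * (k + num / p ^ 2)) := by
    push_cast
    field_simp
    ring
  rw [e, norm_mul, norm_neg]
  have e2 : ‖((κ * β : ℝ) : ℂ) * p ^ 2‖ = κ * ‖(β : ℂ) * p ^ 2‖ := by
    rw [Complex.ofReal_mul, mul_assoc, norm_mul, Complex.norm_real, Real.norm_eq_abs, abs_of_pos hκ]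
  rw [e2]
  have := mul_le_mul_of_nonneg_left h (norm_nonneg ((β : ℂ) * p ^ 2))
  linarith

lemma SepHol.mul' {r : ℝ} {P : ℕ} {F G : (Fin P → ℂ) → ℂ} (hF : SepHol r P F) (hG : SepHol r P G) :
    SepHol r P (fun z => F z * G z) := fun z hz i => (hF z hz i).mul (hG z hz i)

lemma SepHol.add' {r : ℝ} {P : ℕ} {F G : (Fin P → ℂ) → ℂ} (hF : SepHol r P F) (hG : SepHol r P G) :
    SepHol r P (fun z => F z + G z) := fun z hz i => (hF z hz i).add (hG z hz i)

lemma SepHol.sub' {r : ℝ} {P : ℕ} {F G : (Fin P → ℂ) → ℂ} (hF : SepHol r P F) (hG : SepHol r P G) :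
    SepHol r P (fun z => F z - G z) := fun z hz i => (hF z hz i).sub (hG z hz i)

lemma SepHol.pow' {r : ℝ} {P : ℕ} {F : (Fin P → ℂ) → ℂ} (hF : SepHol r P F) (k : ℕ) :
    SepHol r P (fun z => F z ^ k) := fun z hz i => (hF z hz i).pow k

lemma SepHol.const' (r : ℝ) (P : ℕ) (c : ℂ) : SepHol r P (fun _ => c) :=
  fun _ _ _ => differentiableOn_const c

/-- Numerical bounds: `κ` from below. -/
lemma aux_kappa (c y : ℝ) (hc : 0 < c) (hy : 0 < y) : Real.exp (-(1 / c + y)) ≤ c / y := by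
  have h1 : 1 / c ≤ Real.exp (1 / c) := by linarith [Real.add_one_le_exp (1 / c)]
  have h2 : y ≤ Real.exp y := by linarith [Real.add_one_le_exp y]
  rw [Real.exp_neg, Real.exp_add]
  have : c / y = (1 / c * y)⁻¹ := by field_simp
  rw [this]
  apply inv_anti₀ (by positivity)
  gcongr

lemma aux_thr (c C₂ n P L l : ℝ) (hc : 0 < c) (hC₂ : 0 < C₂) (hn : 0 < n) (hP : 0 < P) (hL : 0 < L)
    (hl : 0 < l) (h : n ≤ C₂ * (P * L)) :
    c / 4 / (2 * C₂) ^ l / (P ^ l * L ^ l) ≤ c / (2 * n) ^ l / 4 := by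
  rw [div_div, ← Real.mul_rpow hP.le hL.le, ← Real.mul_rpow (by positivity) (by positivity),
    div_div, div_div, mul_comm ((2 * n) ^ l) 4]
  have : (2 * n) ^ l ≤ (2 * C₂ * (P * L)) ^ l :=
    Real.rpow_le_rpow (by positivity) (by linarith) hl.le
  gcongr

set_option maxHeartbeats 4000000

/-- **Lower bound for approximation by logarithmic-derivative families (second order).**
No family of the form `(1/b_{M,N})(k + ∂ₓ((∂ₓψ)/ψ))`, with `ψ` of exponential type in the
parameters, `∂ₓψ(0,·,·) = 0` and `1/ψ(0,·,·)` at most exponentially large, can approximate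
the whole class `Λ_l([0,1])` on `Ω_{N,M}` better than `C̃/((N+M)^l (ln(N+M))^l)`; the
extremal `h` vanishes on `[0,1/20]`. -/
theorem stmt_4 (m : ℕ) (hm : 1 ≤ m) (α : ℝ) (hα0 : 0 < α) (hα1 : α ≤ 1)
    (A u v b t d : ℝ) (hA : 1 ≤ A) (hu : 1 ≤ u) (hv : 1 ≤ v) (hb : 1 ≤ b)
    (ht : 1 ≤ t) (hd : 1 ≤ d)
    (Ak uk vk bk tk dk : ℝ) (hAk : 1 ≤ Ak) (huk : 1 ≤ uk) (hvk : 1 ≤ vk)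
    (hbk : 1 ≤ bk) (htk : 1 ≤ tk) (hdk : 1 ≤ dk)
    (B₁ B₂ r₁ r₂ : ℝ) (hB₁ : 1 ≤ B₁) (hB₂ : 1 ≤ B₂) (hr₁ : 1 ≤ r₁) (hr₂ : 1 ≤ r₂)
    (ε : ℝ) (hε0 : 0 < ε) (hε1 : ε < 1)
    (C₀ α₀ β₀ : ℝ) (hC₀ : 0 < C₀) (hα₀ : 0 < α₀) (hβ₀ : 0 < β₀)
    (Ck pk Cb pb : ℝ) (hCk : 0 < Ck) (hpk : 0 < pk) (hCb : 0 < Cb) (hpb : 0 < pb) :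
    ∃ C' : ℝ, 0 < C' ∧
      ∀ N M : ℕ, 2 ≤ N →
      ∀ ψ ψx ψxx kf : ℝ → (Fin N → ℂ) → (Fin M → ℂ) → ℂ, ∀ β : ℝ,
      ∀ a : Fin M → ℝ,
      -- ψ is C² in x, with x-derivatives ψx and ψxx
      (∀ (ζ : Fin N → ℂ) (w : Fin M → ℂ), ∀ x ∈ I01,
        HasDerivWithinAt (fun x' => ψ x' ζ w) (ψx x ζ w) I01 x) →
      (∀ (ζ : Fin N → ℂ) (w : Fin M → ℂ), ∀ x ∈ I01,
        HasDerivWithinAt (fun x' => ψx x' ζ w) (ψxx x ζ w) I01 x) →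
      -- ψ, ∂ₓψ, ∂²ₓψ are continuous in x, entire in ζ, holomorphic in w, of exponential growth
      GoodFamily N M A u v b t d ψ →
      GoodFamily N M A u v b t d ψx →
      GoodFamily N M A u v b t d ψxx →
      -- k is continuous in x and entire of exponential type in (ζ,w)
      GoodFamily N M Ak uk vk bk tk dk kf →
      -- the data of Ω_{N,M}
      (∀ i, 0 < a i ∧ a i ≤ B₂ * ((M:ℝ) + N) ^ r₂) →
      -- k is polynomially bounded on Ω_{N,M}
      (∀ (ζ : Fin N → ℝ) (w : Fin M → ℝ), InOmega N M B₁ r₁ ε a ζ w → ∀ x ∈ I01,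
        ‖kf x (fun j => (ζ j : ℂ)) (fun i => (w i : ℂ))‖ ≤ Ck * ((N:ℝ) + M) ^ pk) →
      -- |1/ψ(0,ζ,w)| is at most exponentially large, and ∂ψ/∂x(0,ζ,w) = 0, on Ω_{N,M}
      (∀ (ζ : Fin N → ℝ) (w : Fin M → ℝ), InOmega N M B₁ r₁ ε a ζ w →
        ‖(ψ 0 (fun j => (ζ j : ℂ)) (fun i => (w i : ℂ)))⁻¹‖
            ≤ C₀ * Real.exp (α₀ * ((M:ℝ) + N) ^ β₀) ∧
          ψx 0 (fun j => (ζ j : ℂ)) (fun i => (w i : ℂ)) = 0) →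
      -- b_{M,N} and 1/b_{M,N} are positive and polynomially bounded
      (0 < β ∧ β ≤ Cb * ((N:ℝ) + M) ^ pb ∧ 1 / β ≤ Cb * ((N:ℝ) + M) ^ pb) →
      ∃ h : ℝ → ℝ, HolderClass1 m α h ∧ (∀ x ∈ Icc (0:ℝ) (1/20), h x = 0) ∧
        ∀ (ζ : Fin N → ℝ) (w : Fin M → ℝ), InOmega N M B₁ r₁ ε a ζ w →
          ∃ x ∈ I01,
            C' / (((N:ℝ) + M) ^ ((m:ℝ) + α) * (Real.log ((N:ℝ) + M)) ^ ((m:ℝ) + α)) ≤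
              ‖(h x : ℂ) - ((1 / β : ℝ) : ℂ) *
                (kf x (fun j => (ζ j : ℂ)) (fun i => (w i : ℂ)) +
                  (ψxx x (fun j => (ζ j : ℂ)) (fun i => (w i : ℂ)) *
                      ψ x (fun j => (ζ j : ℂ)) (fun i => (w i : ℂ)) -
                    (ψx x (fun j => (ζ j : ℂ)) (fun i => (w i : ℂ))) ^ 2) /
                  (ψ x (fun j => (ζ j : ℂ)) (fun i => (w i : ℂ))) ^ 2)‖ := by
  classical
  obtain ⟨c, hc0, hc1, hhold⟩ := aux_holder m α hα0 hα1
  have hl : 0 < (m : ℝ) + α := by positivity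
  set q := Real.sqrt (1 - ε / 2) with hq
  have hqq : q * q = 1 - ε / 2 := Real.mul_self_sqrt (by linarith)
  have hq0 : 0 < q := Real.sqrt_pos.2 (by linarith)
  have hq1 : q < 1 := by nlinarith
  set LE := LEf A u v b t d B₁ r₁ B₂ r₂ with hLE
  set LK := LEf Ak uk vk bk tk dk B₁ r₁ B₂ r₂ with hLK
  have hPBE : PB LE := PB_LEf hA hu hv hb ht hd hB₁ hB₂ hr₁ hr₂
  have hPBK : PB LK := PB_LEf hAk huk hvk hbk htk hdk hB₁ hB₂ hr₁ hr₂
  set Lam : ℝ → ℝ := fun x => 2 * (Cb * x ^ pb) + Ck * x ^ pk with hLam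
  have h2 : PB (fun _ => (2 : ℝ)) := PB.const (by norm_num)
  have hPBb : PB (fun x => Cb * x ^ pb) := (PB.const hCb.le).mul (PB.id.rpow hpb.le)
  have hPBL : PB Lam := (h2.mul hPBb).add ((PB.const hCk.le).mul (PB.id.rpow hpk.le))
  set Z : ℝ → ℝ := fun x => C₀ + α₀ * x ^ β₀ + Lam x with hZ
  have hPBZ : PB Z := ((PB.const hC₀.le).add ((PB.const hα₀.le).mul (PB.id.rpow hβ₀.le))).add hPBL
  have hPBk : PB (fun x => 1 / c + (2 * x) ^ ((m : ℝ) + α)) :=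
    (PB.const (by positivity)).add ((h2.mul PB.id).rpow hl.le)
  set X : ℝ → ℝ := fun x => 2 * LE x + LK x + Cb * x ^ pb + 2 +
    (1 / c + (2 * x) ^ ((m : ℝ) + α)) + 2 * Z x with hX
  have hPBX : PB X := (((((h2.mul hPBE).add hPBK).add hPBb).add h2).add hPBk).add (h2.mul hPBZ)
  obtain ⟨C₂, hC₂, hfin⟩ := aux_final q hq0 hq1 X hPBX
  refine ⟨c / 4 / (2 * C₂) ^ ((m : ℝ) + α), by positivity, ?_⟩
  intro N M hN ψ ψx ψxx kf β a hd1 hd2 hgψ hgψx hgψxx hgk ha hkb hψ0 hβ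
  obtain ⟨hβ0, hβ1, hβ2⟩ := hβ
  obtain ⟨n, K, hPn, hK, hnle, hcard, hnum⟩ := hfin (N + M) (by omega)
  have hn1 : 1 ≤ n := by omega
  have hnr : (1 : ℝ) ≤ n := by exact_mod_cast hn1
  have hPnr : (N : ℝ) + M ≤ n := by exact_mod_cast hPn
  have hP2 : (2 : ℝ) ≤ (N : ℝ) + M := by exact_mod_cast (by omega : 2 ≤ N + M)
  have hP1 : (1 : ℝ) ≤ (N : ℝ) + M := by linarith
  have hP1' : (1 : ℝ) ≤ (M : ℝ) + N := by linarith
  have hlogP : 0 < Real.log ((N : ℝ) + M) := Real.log_pos (by linarith)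
  set κ : ℝ := c / (2 * (n : ℝ)) ^ ((m : ℝ) + α) with hκ
  have hpow1 : 1 ≤ (2 * (n : ℝ)) ^ ((m : ℝ) + α) := Real.one_le_rpow (by linarith) hl.le
  have hκ0 : 0 < κ := by positivity
  have hκ1 : κ ≤ 1 := by
    rw [hκ, div_le_one (by linarith)]; linarith
  have hthr : c / 4 / (2 * C₂) ^ ((m : ℝ) + α) / (((N:ℝ) + M) ^ ((m:ℝ) + α) *
      (Real.log ((N:ℝ) + M)) ^ ((m:ℝ) + α)) ≤ κ / 4 := by
    apply aux_thr c C₂ n _ _ _ hc0 hC₂ (by linarith) (by linarith) hlogP hl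
    have := hnle
    push_cast at this
    exact this
  have hκlow : Real.exp (-(1 / c + (2 * (n : ℝ)) ^ ((m : ℝ) + α))) ≤ κ :=
    aux_kappa c _ hc0 (by linarith)
  by_contra! hcon
  choose hσ hσH hσ0 hσv using hhold n hn1
  choose ζσ wσ hΩ herr using fun σ => hcon (hσ σ) (hσH σ) (hσ0 σ)
  -- coordinates
  set r : ℝ := B₁ * ((M : ℝ) + N) ^ r₁ / q with hr
  set ρ : ℝ := (1 - ε) / q with hρ
  have ha0 : ∀ i, 0 < a i := fun i => (ha i).1
  have hPr : 0 < ((M : ℝ) + N) ^ r₁ := Real.rpow_pos_of_pos (by linarith) _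
  have hr0 : 0 < r := by positivity
  have hρ0 : 0 < ρ := div_pos (by linarith) hq0
  have hR0 : (0 : ℝ) ≤ 1 / q := by positivity
  have hρR : ρ * (1 / q) < 1 := by
    have : ρ * (1 / q) = (1 - ε) / (q * q) := by rw [hρ]; field_simp
    rw [this, hqq, div_lt_one (by linarith)]; linarith
  have hrR : r * (1 / q) ≤ 2 * B₁ * ((N : ℝ) + M) ^ r₁ := by
    have : r * (1 / q) = B₁ * ((M : ℝ) + N) ^ r₁ / (q * q) := by rw [hr]; field_simp
    rw [this, hqq, div_le_iff₀ (by linarith), add_comm (N : ℝ) M]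
    have hBP : 0 < B₁ * ((M : ℝ) + N) ^ r₁ := by positivity
    have h12 : (1 : ℝ) ≤ 2 * (1 - ε / 2) := by linarith
    calc B₁ * ((M : ℝ) + N) ^ r₁ = B₁ * ((M : ℝ) + N) ^ r₁ * 1 := by ring
      _ ≤ B₁ * ((M : ℝ) + N) ^ r₁ * (2 * (1 - ε / 2)) := mul_le_mul_of_nonneg_left h12 hBP.le
      _ = _ := by ring
  set pt : (Fin n → Bool) → Fin (N + M) → ℂ := fun σ => ptmap N M r ρ a (ζσ σ) (wσ σ) with hpt
  have hptz : ∀ σ, zmap N M r (pt σ) = fun j => (ζσ σ j : ℂ) := fun σ => ptmap_z a _ _ hr0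
  have hptw : ∀ σ, wmap N M ρ a (pt σ) = fun j => (wσ σ j : ℂ) := fun σ => ptmap_w a _ _ hρ0 ha0
  have hptb : ∀ σ, ∀ j, ‖pt σ j‖ ≤ q := fun σ =>
    ptmap_bound a _ _ hB₁ hP1' hε1 hq0 ha0 (hΩ σ)
  set xs : Fin n → ℝ := fun i => 1 / 2 + ((i : ℕ) + 1 / 2) / (2 * n) with hxs
  have hxsI : ∀ i, xs i ∈ I01 := by
    intro i
    have hi : ((i : ℕ) : ℝ) + 1 ≤ n := by exact_mod_cast i.2
    have h0 : (0 : ℝ) ≤ ((i : ℕ) + 1 / 2) / (2 * n) := by positivity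
    have h1 : (((i : ℕ) : ℝ) + 1 / 2) / (2 * n) ≤ 1 / 2 := by
      rw [div_le_iff₀ (by linarith)]; linarith
    exact ⟨by simp only [hxs]; linarith, by simp only [hxs]; linarith⟩
  have hsep : ∀ {A u v b t d : ℝ} {g : ℝ → (Fin N → ℂ) → (Fin M → ℂ) → ℂ},
      GoodFamily N M A u v b t d g → ∀ i, SepHol (1 / q) (N + M)
        (fun z => g (xs i) (zmap N M r z) (wmap N M ρ a z)) :=
    fun hg i => aux_sep hg r ρ (1 / q) a ha0 hρ0.le hρR _ (hxsI i)
  have hbE : ∀ {g : ℝ → (Fin N → ℂ) → (Fin M → ℂ) → ℂ}, GoodFamily N M A u v b t d g →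
      ∀ i z, (∀ j, ‖z j‖ ≤ 1 / q) → ‖g (xs i) (zmap N M r z) (wmap N M ρ a z)‖ ≤ Real.exp (LE n) :=
    fun hg i z hz => aux_bound hg hA hu hv hb ht hd hB₁ hB₂ hr₁ hr₂ n hP1 hPnr r ρ (1 / q) hr0.le hR0
      hrR a ha hρ0.le hρR _ (hxsI i) z hz
  have hbK : ∀ i z, (∀ j, ‖z j‖ ≤ 1 / q) →
      ‖kf (xs i) (zmap N M r z) (wmap N M ρ a z)‖ ≤ Real.exp (LK n) :=
    fun i z hz => aux_bound hgk hAk huk hvk hbk htk hdk hB₁ hB₂ hr₁ hr₂ n hP1 hPnr r ρ (1 / q) hr0.le hR0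
      hrR a ha hρ0.le hρR _ (hxsI i) z hz
  -- numerical facts
  have nn : ∀ {f : ℝ → ℝ}, PB f → 0 ≤ f n := fun hf => by
    obtain ⟨_, _, _, h⟩ := hf; exact (h n hnr).1
  have nE := nn hPBE
  have nK := nn hPBK
  have nb := nn hPBb
  have nZ := nn hPBZ
  have nk := nn hPBk
  have hβn : β ≤ Cb * (n : ℝ) ^ pb := hβ1.trans (by gcongr)
  have hβn2 : 1 / β ≤ Cb * (n : ℝ) ^ pb := hβ2.trans (by gcongr)
  have hβe : β ≤ Real.exp (Cb * (n : ℝ) ^ pb) := by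
    linarith [Real.add_one_le_exp (Cb * (n : ℝ) ^ pb)]
  have hβlow : Real.exp (-(Cb * (n : ℝ) ^ pb)) ≤ β := by
    rw [Real.exp_neg, inv_le_comm₀ (Real.exp_pos _) hβ0, ← one_div]
    linarith [Real.add_one_le_exp (Cb * (n : ℝ) ^ pb)]
  have hκβ0 : 0 < κ * β := by positivity
  have hκβn : ‖((κ * β : ℝ) : ℂ)‖ = κ * β := by
    rw [Complex.norm_real, Real.norm_eq_abs, abs_of_pos hκβ0]
  have hκβle : κ * β ≤ Real.exp (Cb * (n : ℝ) ^ pb) := by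
    calc κ * β ≤ 1 * β := by gcongr
      _ ≤ _ := by rw [one_mul]; exact hβe
  have hκβlow : Real.exp (-(1 / c + (2 * (n : ℝ)) ^ ((m : ℝ) + α)) + -(Cb * (n : ℝ) ^ pb)) ≤ κ * β := by
    rw [Real.exp_add]; gcongr
  -- consequence of smallness of the error
  have hQ : ∀ σ, ∀ x ∈ I01, ‖(ψxx x (fun j => (ζσ σ j : ℂ)) (fun i => (wσ σ i : ℂ)) *
                      ψ x (fun j => (ζσ σ j : ℂ)) (fun i => (wσ σ i : ℂ)) -
                    (ψx x (fun j => (ζσ σ j : ℂ)) (fun i => (wσ σ i : ℂ))) ^ 2) /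
                  (ψ x (fun j => (ζσ σ j : ℂ)) (fun i => (wσ σ i : ℂ))) ^ 2‖ ≤ Lam n := by
    intro σ x hx
    have h1 := (herr σ x hx).le.trans hthr
    have h2 : |hσ σ x| ≤ 1 := by
      have := (hσH σ).2.1 0 (Nat.zero_le _) x hx
      simpa using this
    have h3 := hkb _ _ (hΩ σ) x hx
    set Q := (ψxx x (fun j => (ζσ σ j : ℂ)) (fun i => (wσ σ i : ℂ)) *
                      ψ x (fun j => (ζσ σ j : ℂ)) (fun i => (wσ σ i : ℂ)) -
                    (ψx x (fun j => (ζσ σ j : ℂ)) (fun i => (wσ σ i : ℂ))) ^ 2) /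
                  (ψ x (fun j => (ζσ σ j : ℂ)) (fun i => (wσ σ i : ℂ))) ^ 2
    set kk := kf x (fun j => (ζσ σ j : ℂ)) (fun i => (wσ σ i : ℂ))
    have h4 : ‖((1 / β : ℝ) : ℂ) * (kk + Q)‖ ≤ 2 := by
      have e : ((1 / β : ℝ) : ℂ) * (kk + Q) = (hσ σ x : ℂ) - ((hσ σ x : ℂ) - ((1 / β : ℝ) : ℂ) * (kk + Q)) := by ring
      rw [e]
      refine (norm_sub_le _ _).trans ?_
      rw [Complex.norm_real, Real.norm_eq_abs]
      linarith
    rw [norm_mul, Complex.norm_real, Real.norm_eq_abs, abs_of_pos (by positivity), one_div,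
      inv_mul_le_iff₀ hβ0] at h4
    have h5 : ‖Q‖ ≤ ‖kk + Q‖ + ‖kk‖ := by
      have : Q = (kk + Q) - kk := by ring
      calc ‖Q‖ = ‖(kk + Q) - kk‖ := by rw [← this]
        _ ≤ _ := norm_sub_le _ _
    have h6 : Ck * ((N : ℝ) + M) ^ pk ≤ Ck * (n : ℝ) ^ pk := by gcongr
    simp only [hLam]
    linarith
  -- values at nodes
  have hnode : ∀ σ i, ‖sgB (σ i) * (κ : ℂ) - ((1 / β : ℝ) : ℂ) *
                (kf (xs i) (fun j => (ζσ σ j : ℂ)) (fun i => (wσ σ i : ℂ)) +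
                  (ψxx (xs i) (fun j => (ζσ σ j : ℂ)) (fun i => (wσ σ i : ℂ)) *
                      ψ (xs i) (fun j => (ζσ σ j : ℂ)) (fun i => (wσ σ i : ℂ)) -
                    (ψx (xs i) (fun j => (ζσ σ j : ℂ)) (fun i => (wσ σ i : ℂ))) ^ 2) /
                  (ψ (xs i) (fun j => (ζσ σ j : ℂ)) (fun i => (wσ σ i : ℂ))) ^ 2)‖ ≤ κ / 4 := by
    intro σ i
    have h1 := (herr σ (xs i) (hxsI i)).le.trans hthr
    rw [hσv σ i, Complex.ofReal_mul, sgR_cast] at h1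
    exact h1
  set SA : Finset (Fin n → Bool) := Finset.univ.filter
    (fun σ => ψ 0 (fun j => (ζσ σ j : ℂ)) (fun i => (wσ σ i : ℂ)) = 0) with hSA
  set SB : Finset (Fin n → Bool) := Finset.univ.filter
    (fun σ => ¬ ψ 0 (fun j => (ζσ σ j : ℂ)) (fun i => (wσ σ i : ℂ)) = 0) with hSB
  have hsum : SA.card + SB.card = 2 ^ n := by
    rw [hSA, hSB, Finset.card_filter_add_card_filter_not]
    simp
  have hA' : SA.card ≤ K ^ (N + M) := by
    refine aux_core q hq0 hq1 K hK (N + M) n hn1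
      (fun i z => kf (xs i) (zmap N M r z) (wmap N M ρ a z)) (fun _ _ => ((κ * β : ℝ) : ℂ))
      (hsep hgk) (fun _ => SepHol.const' _ _ _) (Real.exp (X n)) ?_ ?_ SA pt (fun σ _ => hptb σ)
      (Real.exp (- X n)) (Real.exp_pos _) ?_ ?_ hnum
    · intro i z hz
      refine (hbK i z hz).trans (Real.exp_le_exp.2 ?_)
      simp only [hX]; linarith
    · intro i z hz
      rw [hκβn]
      refine hκβle.trans (Real.exp_le_exp.2 ?_)
      simp only [hX]; linarith
    · intro σ _ i
      rw [hκβn]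
      refine le_trans (Real.exp_le_exp.2 ?_) hκβlow
      simp only [hX]; linarith
    · intro σ hσS i
      have h0 : ψ 0 (fun j => (ζσ σ j : ℂ)) (fun i => (wσ σ i : ℂ)) = 0 := (Finset.mem_filter.1 hσS).2
      have hz := aux_ode_zero _ _ _ (hd1 _ _) (hd2 _ _) (Lam n) (hQ σ) h0 (xs i) (hxsI i)
      have h1 := hnode σ i
      rw [hz] at h1
      have h2 := aux_pt κ β hβ0 hκ0 (sgB (σ i)) 1 (kf (xs i) (fun j => (ζσ σ j : ℂ)) (fun i => (wσ σ i : ℂ))) 0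
        one_ne_zero (by simpa using h1)
      simp only [hptz, hptw]
      simpa using h2
  have hB' : SB.card ≤ K ^ (N + M) := by
    refine aux_core q hq0 hq1 K hK (N + M) n hn1
      (fun i z => kf (xs i) (zmap N M r z) (wmap N M ρ a z) * ψ (xs i) (zmap N M r z) (wmap N M ρ a z) ^ 2 +
        (ψxx (xs i) (zmap N M r z) (wmap N M ρ a z) * ψ (xs i) (zmap N M r z) (wmap N M ρ a z) -
          ψx (xs i) (zmap N M r z) (wmap N M ρ a z) ^ 2))
      (fun i z => ((κ * β : ℝ) : ℂ) * ψ (xs i) (zmap N M r z) (wmap N M ρ a z) ^ 2)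
      (fun i => ((hsep hgk i).mul' ((hsep hgψ i).pow' 2)).add'
        (((hsep hgψxx i).mul' (hsep hgψ i)).sub' ((hsep hgψx i).pow' 2)))
      (fun i => (SepHol.const' _ _ _).mul' ((hsep hgψ i).pow' 2)) (Real.exp (X n)) ?_ ?_ SB pt
      (fun σ _ => hptb σ) (Real.exp (- X n)) (Real.exp_pos _) ?_ ?_ hnum
    · intro i z hz
      have e0 := hbK i z hz
      have e1 := hbE hgψ i z hz
      have e2 := hbE hgψx i z hz
      have e3 := hbE hgψxx i z hz
      have hexp2 : (3 : ℝ) ≤ Real.exp 2 := by linarith [Real.add_one_le_exp (2 : ℝ)]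
      have hek : 1 ≤ Real.exp (LK n) := Real.one_le_exp nK
      calc _ ≤ ‖kf (xs i) (zmap N M r z) (wmap N M ρ a z)‖ * ‖ψ (xs i) (zmap N M r z) (wmap N M ρ a z)‖ ^ 2 +
            (‖ψxx (xs i) (zmap N M r z) (wmap N M ρ a z)‖ * ‖ψ (xs i) (zmap N M r z) (wmap N M ρ a z)‖ +
              ‖ψx (xs i) (zmap N M r z) (wmap N M ρ a z)‖ ^ 2) := by
            rw [← norm_pow, ← norm_pow, ← norm_mul, ← norm_mul]
            exact (norm_add_le _ _).trans (add_le_add le_rfl (norm_sub_le _ _))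
        _ ≤ Real.exp (LK n) * Real.exp (LE n) ^ 2 + (Real.exp (LE n) * Real.exp (LE n) + Real.exp (LE n) ^ 2) := by
            gcongr
        _ = (Real.exp (LK n) + 2) * Real.exp (LE n) ^ 2 := by ring
        _ ≤ (Real.exp 2 * Real.exp (LK n)) * Real.exp (LE n) ^ 2 := by
            gcongr
            linarith [mul_le_mul_of_nonneg_right hexp2 (by linarith : 0 ≤ Real.exp (LK n))]
        _ = Real.exp (2 + LK n + 2 * LE n) := by
            rw [Real.exp_add, Real.exp_add, two_mul (LE n), Real.exp_add]; ring
        _ ≤ _ := by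
            apply Real.exp_le_exp.2
            simp only [hX]; linarith
    · intro i z hz
      have e1 := hbE hgψ i z hz
      rw [norm_mul, norm_pow, hκβn]
      calc _ ≤ Real.exp (Cb * (n : ℝ) ^ pb) * Real.exp (LE n) ^ 2 := by gcongr
        _ = Real.exp (Cb * (n : ℝ) ^ pb + 2 * LE n) := by
            rw [Real.exp_add, two_mul (LE n), Real.exp_add]; ring
        _ ≤ _ := by
            apply Real.exp_le_exp.2
            simp only [hX]; linarith
    · intro σ hσS i
      have h0 : ψ 0 (fun j => (ζσ σ j : ℂ)) (fun i => (wσ σ i : ℂ)) ≠ 0 := (Finset.mem_filter.1 hσS).2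
      obtain ⟨hne, hinv⟩ := aux_ode 1 le_rfl _ _ _ (hd1 _ _) (hd2 _ _) (Lam n) (hQ σ) h0 (xs i) (hxsI i)
      obtain ⟨g1, g2⟩ := hψ0 _ _ (hΩ σ)
      rw [g2, zero_div, norm_zero, zero_add] at hinv
      simp only [hptz, hptw]
      have hlow : Real.exp (- Z n) ≤ ‖ψ (xs i) (fun j => (ζσ σ j : ℂ)) (fun i => (wσ σ i : ℂ))‖ := by
        have hpos : 0 < ‖ψ (xs i) (fun j => (ζσ σ j : ℂ)) (fun i => (wσ σ i : ℂ))‖ := norm_pos_iff.2 hne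
        rw [Real.exp_neg, inv_le_comm₀ (Real.exp_pos _) hpos, ← norm_inv]
        refine hinv.trans ?_
        have hMN : (M : ℝ) + N ≤ n := by linarith
        have hC₀e : C₀ ≤ Real.exp C₀ := by linarith [Real.add_one_le_exp C₀]
        calc _ ≤ (C₀ * Real.exp (α₀ * ((M:ℝ) + N) ^ β₀)) * Real.exp (Lam n) := by gcongr
          _ ≤ (Real.exp C₀ * Real.exp (α₀ * (n:ℝ) ^ β₀)) * Real.exp (Lam n) := by gcongr
          _ = _ := by rw [← Real.exp_add, ← Real.exp_add]
      rw [norm_mul, norm_pow, hκβn]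
      calc Real.exp (- X n) ≤ Real.exp ((-(1 / c + (2 * (n : ℝ)) ^ ((m : ℝ) + α)) + -(Cb * (n : ℝ) ^ pb)) + (- Z n + - Z n)) := by
            apply Real.exp_le_exp.2
            simp only [hX]; linarith
        _ = Real.exp (-(1 / c + (2 * (n : ℝ)) ^ ((m : ℝ) + α)) + -(Cb * (n : ℝ) ^ pb)) * Real.exp (- Z n) ^ 2 := by
            rw [Real.exp_add _ (- Z n + - Z n), Real.exp_add (- Z n), pow_two]
        _ ≤ _ := by gcongr
    · intro σ hσS i
      have h0 : ψ 0 (fun j => (ζσ σ j : ℂ)) (fun i => (wσ σ i : ℂ)) ≠ 0 := (Finset.mem_filter.1 hσS).2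
      obtain ⟨hne, -⟩ := aux_ode 1 le_rfl _ _ _ (hd1 _ _) (hd2 _ _) (Lam n) (hQ σ) h0 (xs i) (hxsI i)
      simp only [hptz, hptw]
      exact aux_pt κ β hβ0 hκ0 _ _ _ _ hne (hnode σ i)
  omega

end
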